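/- Fix a correlation ρ with −1 < ρ < 1 and an integer m ≥ 2. Then the set of m×m probability distribution matrices noninteractively simulatable from ρ-correlated Gaussian sources of dimension m²−1 equals the closure of the union over all dimensions: S_{ρ,m}(m²−1) = closure(⋃_{j=1}^∞ S_{ρ,m}(j)), where the closure is taken in ℝ^{m×m}. -/

import Mathlib

open MeasureTheory

noncomputable def gauss (d : ℕ) : Measure (EuclideanSpace ℝ (Fin d)) :=
  volume.withDensity (fun x => ENNReal.ofReal ((2 * Real.pi) ^ (-(d : ℝ) / 2) * Real.exp (-‖x‖ ^ 2 / 2)))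

noncomputable def OU (d : ℕ) (ρ : ℝ) (f : EuclideanSpace ℝ (Fin d) → ℝ)
    (x : EuclideanSpace ℝ (Fin d)) : ℝ :=
  ∫ y, f (ρ • x + Real.sqrt (1 - ρ ^ 2) • y) ∂(gauss d)

noncomputable def Cmat (d m : ℕ) (ρ : ℝ)
    (f g : EuclideanSpace ℝ (Fin d) → (Fin m → ℝ)) : Matrix (Fin m) (Fin m) ℝ :=
  Matrix.of fun i j => ∫ x, f x i * OU d ρ (fun y => g y j) x ∂(gauss d)

def SimplexMap (d m : ℕ) (f : EuclideanSpace ℝ (Fin d) → (Fin m → ℝ)) : Prop :=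
  Measurable f ∧ ∀ x, f x ∈ stdSimplex ℝ (Fin m)

noncomputable def Sset (ρ : ℝ) (m d : ℕ) : Set (Matrix (Fin m) (Fin m) ℝ) :=
  { M | ∃ f g, SimplexMap d m f ∧ SimplexMap d m g ∧ M = Cmat d m ρ f g }

open ProbabilityTheory Filter Topology

/-- The standard Gaussian density on `ℝ^d`. -/
noncomputable def gaussDensity (d : ℕ) (x : EuclideanSpace ℝ (Fin d)) : ℝ :=
  (2 * Real.pi) ^ (-(d : ℝ) / 2) * Real.exp (-‖x‖ ^ 2 / 2)

lemma gaussDensity_pos (d : ℕ) (x : EuclideanSpace ℝ (Fin d)) : 0 < gaussDensity d x := by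
  unfold gaussDensity; positivity

@[fun_prop]
lemma continuous_gaussDensity (d : ℕ) : Continuous (gaussDensity d) := by
  unfold gaussDensity; fun_prop

lemma integral_gauss {F : Type*} [NormedAddCommGroup F] [NormedSpace ℝ F] (d : ℕ)
    (f : EuclideanSpace ℝ (Fin d) → F) :
    ∫ x, f x ∂(gauss d) = ∫ x, gaussDensity d x • f x := by
  have hm : Measurable (fun x => ENNReal.ofReal (gaussDensity d x)) :=
    (continuous_gaussDensity d).measurable.ennreal_ofReal
  have := integral_withDensity_eq_integral_toReal_smul hm (μ := volume)
    (Eventually.of_forall fun x => ENNReal.ofReal_lt_top) f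
  refine this.trans (integral_congr_ae (Eventually.of_forall fun x => ?_))
  simp [ENNReal.toReal_ofReal (gaussDensity_pos d x).le]

lemma integrable_gaussDensity (d : ℕ) : Integrable (gaussDensity d) := by
  have h := GaussianFourier.integrable_cexp_neg_mul_sq_norm_add (b := 1 / 2) (by norm_num) 0
    (0 : EuclideanSpace ℝ (Fin d))
  have h2 := h.re.const_mul ((2 * Real.pi) ^ (-(d : ℝ) / 2))
  refine h2.congr (Eventually.of_forall fun x => ?_)
  simp only [gaussDensity, zero_mul, add_zero]
  congr 1
  rw [show (-(1 / 2 : ℂ) * (‖x‖ : ℂ) ^ 2) = ((-‖x‖ ^ 2 / 2 : ℝ) : ℂ) by push_cast; ring]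
  exact Complex.exp_ofReal_re _

lemma integral_gaussDensity (d : ℕ) : ∫ x, gaussDensity d x = 1 := by
  have h := GaussianFourier.integral_rexp_neg_mul_sq_norm (b := 1 / 2) (by norm_num)
    (V := EuclideanSpace ℝ (Fin d))
  unfold gaussDensity
  rw [integral_const_mul]
  have e : ∀ x : EuclideanSpace ℝ (Fin d), -‖x‖ ^ 2 / 2 = -(1 / 2) * ‖x‖ ^ 2 := fun x => by ring
  simp_rw [e, h]
  rw [finrank_euclideanSpace_fin, show Real.pi / (1 / 2) = 2 * Real.pi by ring,
    ← Real.rpow_add (by positivity)]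
  rw [show -(d : ℝ) / 2 + d / 2 = 0 by ring, Real.rpow_zero]

instance isProbabilityMeasure_gauss (d : ℕ) : IsProbabilityMeasure (gauss d) := by
  constructor
  change (volume.withDensity fun x => ENNReal.ofReal (gaussDensity d x)) Set.univ = 1
  rw [withDensity_apply _ MeasurableSet.univ, Measure.restrict_univ,
    ← ofReal_integral_eq_lintegral_ofReal (integrable_gaussDensity d)
      (Eventually.of_forall fun x => (gaussDensity_pos d x).le), integral_gaussDensity]
  simp

lemma gauss_eq_stdGaussian (d : ℕ) : gauss d = stdGaussian (EuclideanSpace ℝ (Fin d)) := by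
  apply Measure.ext_of_charFun
  ext t
  rw [charFun_stdGaussian, charFun_apply, integral_gauss]
  have h := GaussianFourier.integral_cexp_neg_mul_sq_norm_add (b := 1 / 2) (by norm_num) Complex.I t
  have e : ∀ x : EuclideanSpace ℝ (Fin d),
      gaussDensity d x • Complex.exp ((inner ℝ x t : ℝ) * Complex.I) =
      (((2 * Real.pi) ^ (-(d : ℝ) / 2) : ℝ) : ℂ) *
        Complex.exp (-(1 / 2) * (‖x‖ : ℂ) ^ 2 + Complex.I * (inner ℝ t x : ℝ)) := fun x => by
    rw [Complex.exp_add, gaussDensity, Complex.real_smul, real_inner_comm]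
    push_cast
    rw [mul_assoc]
    congr 3
    · ring
    · ring
  simp_rw [e]
  rw [integral_const_mul, h, ← mul_assoc, finrank_euclideanSpace_fin,
    show ((Real.pi : ℂ) / (1 / 2)) = ((2 * Real.pi : ℝ) : ℂ) by push_cast; ring,
    show ((d : ℂ) / 2) = ((d / 2 : ℝ) : ℂ) by push_cast; ring,
    ← Complex.ofReal_cpow (by positivity), ← Complex.ofReal_mul, ← Real.rpow_add (by positivity),
    show -(d : ℝ) / 2 + d / 2 = 0 by ring, Real.rpow_zero, Complex.I_sq]
  simp only [Complex.ofReal_one, one_mul]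
  congr 1
  ring

lemma integrable_exp_norm_gauss (d : ℕ) (c : ℝ) :
    Integrable (fun x => Real.exp (c * ‖x‖)) (gauss d) := by
  rw [gauss_eq_stdGaussian]
  obtain ⟨C, hC, hi⟩ := IsGaussian.exists_integrable_exp_sq
    (stdGaussian (EuclideanSpace ℝ (Fin d)))
  refine (hi.const_mul (Real.exp (c ^ 2 / (4 * C)))).mono' (by fun_prop)
    (Eventually.of_forall fun x => ?_)
  rw [Real.norm_eq_abs, Real.abs_exp, ← Real.exp_add, Real.exp_le_exp]
  have : c ^ 2 / (4 * C) + C * ‖x‖ ^ 2 - c * ‖x‖ = (2 * C * ‖x‖ - c) ^ 2 / (4 * C) := by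
    field_simp; ring
  have h2 : 0 ≤ (2 * C * ‖x‖ - c) ^ 2 / (4 * C) := by positivity
  linarith

lemma gauss_absolutelyContinuous (d : ℕ) : gauss d ≪ volume :=
  withDensity_absolutelyContinuous _ _

lemma volume_absolutelyContinuous_gauss (d : ℕ) :
    (volume : Measure (EuclideanSpace ℝ (Fin d))) ≪ gauss d :=
  withDensity_absolutelyContinuous' (continuous_gaussDensity d).measurable.ennreal_ofReal.aemeasurable
    (Eventually.of_forall fun x => (ENNReal.ofReal_pos.2 (gaussDensity_pos d x)).ne')

/-- The Cameron–Martin density of the translation by `h`. -/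
noncomputable def shiftDensity {d : ℕ} (h x : EuclideanSpace ℝ (Fin d)) : ℝ :=
  Real.exp (inner ℝ h x - ‖h‖ ^ 2 / 2)

lemma gaussDensity_sub (d : ℕ) (h x : EuclideanSpace ℝ (Fin d)) :
    gaussDensity d (x - h) = gaussDensity d x * shiftDensity h x := by
  rw [gaussDensity, gaussDensity, shiftDensity, mul_assoc, ← Real.exp_add, norm_sub_sq_real,
    real_inner_comm]
  congr 2
  ring

lemma integral_gauss_add (d : ℕ) (h : EuclideanSpace ℝ (Fin d)) (F : EuclideanSpace ℝ (Fin d) → ℝ) :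
    ∫ x, F (x + h) ∂(gauss d) = ∫ x, F x * shiftDensity h x ∂(gauss d) := by
  rw [integral_gauss, integral_gauss,
    ← integral_sub_right_eq_self (fun x => gaussDensity d x • F (x + h)) h]
  congr 1 with x
  simp only [sub_add_cancel, smul_eq_mul, gaussDensity_sub]
  ring

lemma ae_gauss_add {d : ℕ} {p : EuclideanSpace ℝ (Fin d) → Prop} (hp : ∀ᵐ x ∂(gauss d), p x)
    (h : EuclideanSpace ℝ (Fin d)) : ∀ᵐ x ∂(gauss d), p (x + h) := by
  have h1 := (volume_absolutelyContinuous_gauss d).ae_le hp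
  have h2 := (measurePreserving_add_right volume h).quasiMeasurePreserving.ae h1
  exact (gauss_absolutelyContinuous d).ae_le h2

/-- The Mehler kernel, i.e. the density of the Ornstein–Uhlenbeck operator. -/
noncomputable def mehler (d : ℕ) (ρ : ℝ) (x y : EuclideanSpace ℝ (Fin d)) : ℝ :=
  |(Real.sqrt (1 - ρ ^ 2) ^ d)⁻¹| *
    Real.exp ((2 * ρ * inner ℝ x y - ρ ^ 2 * ‖x‖ ^ 2 - ρ ^ 2 * ‖y‖ ^ 2) / (2 * (1 - ρ ^ 2)))

lemma mehler_comm (d : ℕ) (ρ : ℝ) (x y : EuclideanSpace ℝ (Fin d)) :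
    mehler d ρ x y = mehler d ρ y x := by
  rw [mehler, mehler, real_inner_comm]
  congr 3; ring

lemma mehler_nonneg (d : ℕ) (ρ : ℝ) (x y : EuclideanSpace ℝ (Fin d)) : 0 ≤ mehler d ρ x y := by
  unfold mehler; positivity

lemma continuous_mehler (d : ℕ) (ρ : ℝ) :
    Continuous (fun p : EuclideanSpace ℝ (Fin d) × EuclideanSpace ℝ (Fin d) =>
      mehler d ρ p.1 p.2) := by
  unfold mehler; fun_prop

lemma mehler_le (d : ℕ) {ρ : ℝ} (hρ : ρ ^ 2 < 1) (x : EuclideanSpace ℝ (Fin d)) :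
    ∃ C, ∀ y, mehler d ρ x y ≤ C := by
  refine ⟨|(Real.sqrt (1 - ρ ^ 2) ^ d)⁻¹| * Real.exp (‖x‖ ^ 2 / (2 * (1 - ρ ^ 2))), fun y => ?_⟩
  unfold mehler
  have hs : 0 < 1 - ρ ^ 2 := by linarith
  gcongr
  have h := real_inner_le_norm x (ρ • y)
  rw [inner_smul_right, norm_smul] at h
  have h3 : (‖ρ‖ * ‖y‖) ^ 2 = ρ ^ 2 * ‖y‖ ^ 2 := by rw [mul_pow, Real.norm_eq_abs, sq_abs]
  nlinarith [sq_nonneg (‖x‖ - ‖ρ‖ * ‖y‖), mul_nonneg (sq_nonneg ρ) (sq_nonneg ‖x‖)]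

lemma OU_eq_mehler (d : ℕ) {ρ : ℝ} (hρ : ρ ^ 2 < 1) (f : EuclideanSpace ℝ (Fin d) → ℝ)
    (x : EuclideanSpace ℝ (Fin d)) :
    OU d ρ f x = ∫ y, f y * mehler d ρ x y ∂(gauss d) := by
  have hs : 0 < 1 - ρ ^ 2 := by linarith
  set σ := Real.sqrt (1 - ρ ^ 2) with hσ
  have hσ0 : 0 < σ := Real.sqrt_pos.2 hs
  have hσ2 : σ ^ 2 = 1 - ρ ^ 2 := Real.sq_sqrt hs.le
  have h1 := Measure.integral_comp_smul (volume : Measure (EuclideanSpace ℝ (Fin d)))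
    (fun w => gaussDensity d (σ⁻¹ • w) • f (ρ • x + w)) σ
  rw [OU, integral_gauss, integral_gauss]
  have h2 : ∀ y : EuclideanSpace ℝ (Fin d), σ⁻¹ • σ • y = y := fun y => inv_smul_smul₀ hσ0.ne' y
  simp only [h2] at h1
  rw [h1, finrank_euclideanSpace_fin, ← integral_smul,
    ← integral_sub_right_eq_self (μ := volume) (fun y => _) (ρ • x)]
  congr 1 with y
  simp only [smul_eq_mul, add_sub_cancel]
  rw [mehler, gaussDensity, gaussDensity, ← hσ]
  have e : -‖σ⁻¹ • (y - ρ • x)‖ ^ 2 / 2 = -‖y‖ ^ 2 / 2 +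
      (2 * ρ * inner ℝ x y - ρ ^ 2 * ‖x‖ ^ 2 - ρ ^ 2 * ‖y‖ ^ 2) / (2 * (1 - ρ ^ 2)) := by
    rw [norm_smul, mul_pow, norm_sub_sq_real, inner_smul_right, norm_smul, mul_pow,
      Real.norm_eq_abs, Real.norm_eq_abs, sq_abs, sq_abs, inv_pow, hσ2, real_inner_comm]
    field_simp
    ring
  rw [e, Real.exp_add]
  ring

/-- Measurable functions with values in `[-1, 1]`. -/
def UnitBdd {d : ℕ} (f : EuclideanSpace ℝ (Fin d) → ℝ) : Prop :=
  Measurable f ∧ ∀ x, |f x| ≤ 1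

lemma integrable_of_bounded {d : ℕ} {f : EuclideanSpace ℝ (Fin d) → ℝ} (hf : Measurable f) {B : ℝ}
    (hB : ∀ x, |f x| ≤ B) : Integrable f (gauss d) :=
  Integrable.of_bound hf.aestronglyMeasurable B (Eventually.of_forall hB)

lemma UnitBdd.integrable {d : ℕ} {f : EuclideanSpace ℝ (Fin d) → ℝ} (hf : UnitBdd f) :
    Integrable f (gauss d) := integrable_of_bounded hf.1 hf.2

lemma UnitBdd.mul {d : ℕ} {f g : EuclideanSpace ℝ (Fin d) → ℝ} (hf : UnitBdd f) (hg : UnitBdd g) :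
    UnitBdd (fun x => f x * g x) :=
  ⟨hf.1.mul hg.1, fun x => by
    rw [abs_mul]; exact mul_le_one₀ (hf.2 x) (abs_nonneg _) (hg.2 x)⟩

lemma UnitBdd.comp {d : ℕ} {f : EuclideanSpace ℝ (Fin d) → ℝ} (hf : UnitBdd f)
    {φ : EuclideanSpace ℝ (Fin d) → EuclideanSpace ℝ (Fin d)} (hφ : Measurable φ) :
    UnitBdd (fun x => f (φ x)) :=
  ⟨hf.1.comp hφ, fun _ => hf.2 _⟩

lemma UnitBdd.abs_integral_le {d : ℕ} {f : EuclideanSpace ℝ (Fin d) → ℝ} (hf : UnitBdd f) :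
    |∫ x, f x ∂(gauss d)| ≤ 1 := by
  have := norm_integral_le_of_norm_le_const (μ := gauss d)
    (Eventually.of_forall fun x => (Real.norm_eq_abs (f x)).trans_le (hf.2 x))
  simpa using this

lemma UnitBdd.OU {d : ℕ} {f : EuclideanSpace ℝ (Fin d) → ℝ} (hf : UnitBdd f) (ρ : ℝ) :
    UnitBdd (OU d ρ f) := by
  refine ⟨?_, fun x => (hf.comp (by fun_prop)).abs_integral_le⟩
  have : StronglyMeasurable (fun p : EuclideanSpace ℝ (Fin d) × EuclideanSpace ℝ (Fin d) =>
      f (ρ • p.1 + Real.sqrt (1 - ρ ^ 2) • p.2)) :=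
    (hf.1.comp (by fun_prop)).stronglyMeasurable
  exact this.integral_prod_right'.measurable

lemma OU_comp_add (d : ℕ) (ρ : ℝ) (f : EuclideanSpace ℝ (Fin d) → ℝ)
    (h x : EuclideanSpace ℝ (Fin d)) :
    OU d ρ (fun y => f (y + ρ • h)) x = OU d ρ f (x + h) := by
  unfold OU
  congr 1 with y
  rw [smul_add, add_right_comm]

lemma OU_add_smul (d : ℕ) {ρ : ℝ} (hρ : ρ ^ 2 < 1) (f : EuclideanSpace ℝ (Fin d) → ℝ)
    (v x : EuclideanSpace ℝ (Fin d)) (τ : ℝ) :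
    OU d ρ f (x + τ • v) = ∫ y, f (ρ • x + Real.sqrt (1 - ρ ^ 2) • y) *
      shiftDensity ((ρ / Real.sqrt (1 - ρ ^ 2) * τ) • v) y ∂(gauss d) := by
  have hσ0 : 0 < Real.sqrt (1 - ρ ^ 2) := Real.sqrt_pos.2 (by linarith)
  rw [← integral_gauss_add d _ (fun y => f (ρ • x + Real.sqrt (1 - ρ ^ 2) • y)), OU]
  congr 1 with y
  congr 1
  rw [smul_add, smul_add, smul_smul, smul_smul, ← mul_assoc, mul_div_cancel₀ _ hσ0.ne']
  abel

lemma integrable_mehler_prod {d : ℕ} {ρ : ℝ} (hρ : ρ ^ 2 < 1) :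
    Integrable (fun p : EuclideanSpace ℝ (Fin d) × EuclideanSpace ℝ (Fin d) =>
      mehler d ρ p.1 p.2) ((gauss d).prod (gauss d)) := by
  have h1 : ∀ x, ∫ y, ‖mehler d ρ x y‖ ∂(gauss d) = 1 := fun x => by
    have := OU_eq_mehler d hρ (fun _ => 1) x
    simp only [OU, integral_const, probReal_univ, smul_eq_mul, one_mul] at this
    simp_rw [Real.norm_of_nonneg (mehler_nonneg d ρ x _)]
    exact this.symm
  rw [integrable_prod_iff (continuous_mehler d ρ).aestronglyMeasurable]
  refine ⟨Eventually.of_forall fun x => ?_, ?_⟩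
  · obtain ⟨C, hC⟩ := mehler_le d hρ x
    refine integrable_of_bounded (B := C) ?_ fun y => ?_
    · exact ((continuous_mehler d ρ).comp (by fun_prop : Continuous fun y => (x, y))).measurable
    · rw [abs_of_nonneg (mehler_nonneg d ρ x y)]; exact hC y
  · simp_rw [h1]; exact integrable_const _

lemma integral_mul_OU_comm {d : ℕ} {ρ : ℝ} (hρ : ρ ^ 2 < 1) {f g : EuclideanSpace ℝ (Fin d) → ℝ}
    (hf : UnitBdd f) (hg : UnitBdd g) :
    ∫ x, f x * OU d ρ g x ∂(gauss d) = ∫ x, g x * OU d ρ f x ∂(gauss d) := by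
  have hi : Integrable (fun p : EuclideanSpace ℝ (Fin d) × EuclideanSpace ℝ (Fin d) =>
      f p.1 * (g p.2 * mehler d ρ p.1 p.2)) ((gauss d).prod (gauss d)) := by
    refine (integrable_mehler_prod hρ).mono ?_ (Eventually.of_forall fun p => ?_)
    · exact ((hf.1.comp measurable_fst).mul ((hg.1.comp measurable_snd).mul
        (continuous_mehler d ρ).measurable)).aestronglyMeasurable
    · rw [norm_mul, norm_mul, ← mul_assoc]
      exact mul_le_of_le_one_left (norm_nonneg _)
        (mul_le_one₀ (hf.2 _) (norm_nonneg _) (hg.2 _))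
  simp_rw [OU_eq_mehler d hρ, ← integral_const_mul]
  rw [integral_integral_swap hi]
  congr 1 with y
  congr 1 with x
  rw [mehler_comm]; ring

section Expansion

variable {d : ℕ}

/-- The quadratic coefficient of the Cameron–Martin density. -/
noncomputable def shiftQuad (v x : EuclideanSpace ℝ (Fin d)) : ℝ := (inner ℝ v x ^ 2 - ‖v‖ ^ 2) / 2

lemma abs_exp_sub_quadratic_le (y : ℝ) :
    |Real.exp y - (1 + y + y ^ 2 / 2)| ≤ |y| ^ 3 * Real.exp |y| := by
  have h := Complex.norm_exp_sub_sum_le_norm_mul_exp (y : ℂ) 3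
  rw [Complex.norm_real, Real.norm_eq_abs] at h
  refine le_of_eq_of_le ?_ h
  rw [← Real.norm_eq_abs, ← Complex.norm_real]
  congr 1
  simp [Finset.sum_range_succ, Nat.factorial]

lemma abs_shiftDensity_sub_le (v x : EuclideanSpace ℝ (Fin d)) {s : ℝ} (hs : |s| ≤ 1) :
    |shiftDensity (s • v) x - (1 + s * inner ℝ v x + s ^ 2 * shiftQuad v x)| ≤
      |s| ^ 3 * (8 * Real.exp (2 * (‖v‖ * ‖x‖ + ‖v‖ ^ 2))) := by
  set p : ℝ := inner ℝ v x with hp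
  set c := ‖v‖ ^ 2 with hc
  have hc0 : 0 ≤ c := by positivity
  set q := ‖v‖ * ‖x‖ + c with hq
  have hpq : |p| + c ≤ q := by
    have := abs_real_inner_le_norm v x
    simp only [hq, hp]; linarith
  have hq0 : 0 ≤ q := by positivity
  have hy : shiftDensity (s • v) x = Real.exp (s * p - s ^ 2 * c / 2) := by
    rw [shiftDensity, real_inner_smul_left, norm_smul, mul_pow, Real.norm_eq_abs, sq_abs]
  set y := s * p - s ^ 2 * c / 2 with hydef
  have hs2 : |s| ^ 2 ≤ |s| := by nlinarith [abs_nonneg s]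
  have hyq : |y| ≤ |s| * q := by
    calc |y| ≤ |s * p| + |s ^ 2 * c / 2| := abs_sub _ _
      _ = |s| * |p| + |s| ^ 2 * c / 2 := by
        rw [abs_mul, abs_div, abs_mul, abs_pow, abs_of_nonneg hc0, abs_two]
      _ ≤ |s| * (|p| + c) := by nlinarith [abs_nonneg s]
      _ ≤ |s| * q := by gcongr
  have hyq' : |y| ≤ q := hyq.trans (mul_le_of_le_one_left hq0 hs)
  have h1 : |Real.exp y - (1 + y + y ^ 2 / 2)| ≤ |s| ^ 3 * (q ^ 3 * Real.exp q) := by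
    refine (abs_exp_sub_quadratic_le y).trans ?_
    calc |y| ^ 3 * Real.exp |y| ≤ (|s| * q) ^ 3 * Real.exp q := by gcongr
      _ = _ := by ring
  have h2 : |(1 + y + y ^ 2 / 2) - (1 + s * p + s ^ 2 * shiftQuad v x)| ≤ |s| ^ 3 * q ^ 2 := by
    have e : (1 + y + y ^ 2 / 2) - (1 + s * p + s ^ 2 * shiftQuad v x) =
        s ^ 3 * (s * c ^ 2 / 8 - p * c / 2) := by
      simp only [shiftQuad, ← hp, ← hc, hydef]; ring
    rw [e, abs_mul, abs_pow]
    gcongr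
    calc |s * c ^ 2 / 8 - p * c / 2| ≤ |s * c ^ 2 / 8| + |p * c / 2| := abs_sub _ _
      _ = |s| * c ^ 2 / 8 + |p| * c / 2 := by
        simp [abs_div, abs_mul, abs_of_nonneg hc0]
      _ ≤ (|p| + c) ^ 2 := by
        nlinarith [abs_nonneg p, abs_nonneg s, sq_nonneg c,
          mul_nonneg (abs_nonneg p) hc0, mul_le_mul_of_nonneg_right hs (sq_nonneg c)]
      _ ≤ q ^ 2 := by gcongr
  have h3 : q ^ 3 ≤ 6 * Real.exp q := by
    have := Real.pow_div_factorial_le_exp q hq0 3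
    norm_num [Nat.factorial] at this; linarith
  have h4 : q ^ 2 ≤ 2 * Real.exp q := by
    have := Real.pow_div_factorial_le_exp q hq0 2
    norm_num [Nat.factorial] at this; linarith
  have h5 : Real.exp (2 * q) = Real.exp q * Real.exp q := by rw [← Real.exp_add]; ring_nf
  have h6 : 1 ≤ Real.exp q := Real.one_le_exp hq0
  rw [hy]
  calc _ ≤ |Real.exp y - (1 + y + y ^ 2 / 2)| +
        |(1 + y + y ^ 2 / 2) - (1 + s * p + s ^ 2 * shiftQuad v x)| := abs_sub_le _ _ _
    _ ≤ |s| ^ 3 * (q ^ 3 * Real.exp q) + |s| ^ 3 * q ^ 2 := add_le_add h1 h2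
    _ = |s| ^ 3 * (q ^ 3 * Real.exp q + q ^ 2) := by ring
    _ ≤ _ := by
      gcongr
      rw [h5]; nlinarith [Real.exp_pos q]

lemma integrable_exp_norm_mul (a b : ℝ) :
    Integrable (fun x => Real.exp (2 * (a * ‖x‖ + b))) (gauss d) := by
  have := (integrable_exp_norm_gauss d (2 * a)).mul_const (Real.exp (2 * b))
  refine this.congr (Eventually.of_forall fun x => ?_)
  simp only [← Real.exp_add]; ring_nf

lemma integrable_inner_gauss (v : EuclideanSpace ℝ (Fin d)) :
    Integrable (fun x => inner ℝ v x) (gauss d) := by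
  have : Integrable (fun x => x) (gauss d) := by
    rw [gauss_eq_stdGaussian]; exact IsGaussian.integrable_id
  exact this.const_inner v

lemma integrable_shiftQuad (v : EuclideanSpace ℝ (Fin d)) :
    Integrable (fun x => shiftQuad v x) (gauss d) := by
  have h : MemLp (fun x => x) 2 (gauss d) := by
    rw [gauss_eq_stdGaussian]; exact IsGaussian.memLp_two_id
  exact ((h.const_inner v).integrable_sq.sub (integrable_const _)).div_const 2

lemma integrable_shiftDensity (h : EuclideanSpace ℝ (Fin d)) :
    Integrable (fun x => shiftDensity h x) (gauss d) := by
  refine (integrable_exp_norm_gauss d ‖h‖).mono' (by unfold shiftDensity; fun_prop)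
    (Eventually.of_forall fun x => ?_)
  rw [shiftDensity, Real.norm_eq_abs, Real.abs_exp, Real.exp_le_exp]
  have := real_inner_le_norm h x
  nlinarith [sq_nonneg ‖h‖]

lemma integral_shiftDensity (h : EuclideanSpace ℝ (Fin d)) :
    ∫ x, shiftDensity h x ∂(gauss d) = 1 := by
  have := integral_gauss_add d h (fun _ => 1)
  simpa using this.symm

lemma integral_mul_shiftDensity_expansion (v : EuclideanSpace ℝ (Fin d)) :
    ∃ C, ∀ φ : EuclideanSpace ℝ (Fin d) → ℝ, Measurable φ → ∀ B, (∀ x, |φ x| ≤ B) →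
      ∀ s : ℝ, |s| ≤ 1 → |∫ x, φ x * shiftDensity (s • v) x ∂(gauss d) -
        (∫ x, φ x ∂(gauss d) + s * ∫ x, φ x * inner ℝ v x ∂(gauss d) +
          s ^ 2 * ∫ x, φ x * shiftQuad v x ∂(gauss d))| ≤ C * B * |s| ^ 3 := by
  have hK := (integrable_exp_norm_mul (d := d) ‖v‖ (‖v‖ ^ 2)).const_mul 8
  refine ⟨∫ x, 8 * Real.exp (2 * (‖v‖ * ‖x‖ + ‖v‖ ^ 2)) ∂(gauss d), fun φ hφ B hB s hs => ?_⟩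
  have i0 : Integrable φ (gauss d) := integrable_of_bounded hφ hB
  have hφb : ∀ᵐ x ∂(gauss d), ‖φ x‖ ≤ B := Eventually.of_forall hB
  have i1 := (integrable_inner_gauss v).bdd_mul hφ.aestronglyMeasurable hφb
  have i2 := (integrable_shiftQuad v).bdd_mul hφ.aestronglyMeasurable hφb
  have i3 := (integrable_shiftDensity (s • v)).bdd_mul hφ.aestronglyMeasurable hφb
  have i4 : Integrable (fun x => φ x + s * (φ x * inner ℝ v x)) (gauss d) :=
    i0.add (i1.const_mul s)
  have i5 : Integrable (fun x => φ x + s * (φ x * inner ℝ v x) + s ^ 2 * (φ x * shiftQuad v x))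
      (gauss d) := i4.add (i2.const_mul _)
  rw [← integral_const_mul, ← integral_const_mul, ← integral_add i0 (i1.const_mul s),
    ← integral_add i4 (i2.const_mul _), ← integral_sub i3 i5, mul_assoc,
    ← integral_mul_const, ← Real.norm_eq_abs]
  refine norm_integral_le_of_norm_le (hK.mul_const _) (Eventually.of_forall fun x => ?_)
  have e : φ x * shiftDensity (s • v) x - (φ x + s * (φ x * inner ℝ v x) +
      s ^ 2 * (φ x * shiftQuad v x)) = φ x * (shiftDensity (s • v) x -
        (1 + s * inner ℝ v x + s ^ 2 * shiftQuad v x)) := by ring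
  rw [e, norm_mul]
  calc _ ≤ B * (|s| ^ 3 * (8 * Real.exp (2 * (‖v‖ * ‖x‖ + ‖v‖ ^ 2)))) :=
        mul_le_mul (hB x) (abs_shiftDensity_sub_le v x hs) (abs_nonneg _)
          ((abs_nonneg _).trans (hB x))
    _ = _ := by ring

end Expansion

section OUExpansion

variable {d : ℕ} {ρ : ℝ}

/-- The first-order coefficient of the Ornstein–Uhlenbeck operator along the direction `v`. -/
noncomputable def ouLin (ρ : ℝ) (z : EuclideanSpace ℝ (Fin d) → ℝ)
    (v x : EuclideanSpace ℝ (Fin d)) : ℝ :=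
  ∫ y, z (ρ • x + Real.sqrt (1 - ρ ^ 2) • y) * inner ℝ v y ∂(gauss d)

/-- The second-order coefficient of the Ornstein–Uhlenbeck operator along the direction `v`. -/
noncomputable def ouQuad (ρ : ℝ) (z : EuclideanSpace ℝ (Fin d) → ℝ)
    (v x : EuclideanSpace ℝ (Fin d)) : ℝ :=
  ∫ y, z (ρ • x + Real.sqrt (1 - ρ ^ 2) • y) * shiftQuad v y ∂(gauss d)

lemma measurable_integral_mul {z : EuclideanSpace ℝ (Fin d) → ℝ} (hz : Measurable z) (a b : ℝ)
    {k : EuclideanSpace ℝ (Fin d) → ℝ} (hk : Measurable k) :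
    Measurable (fun x => ∫ y, z (a • x + b • y) * k y ∂(gauss d)) := by
  have : StronglyMeasurable (fun p : EuclideanSpace ℝ (Fin d) × EuclideanSpace ℝ (Fin d) =>
      z (a • p.1 + b • p.2) * k p.2) :=
    ((hz.comp (by fun_prop)).mul (hk.comp measurable_snd)).stronglyMeasurable
  exact this.integral_prod_right'.measurable

lemma abs_integral_mul_le {z : EuclideanSpace ℝ (Fin d) → ℝ} (hz : UnitBdd z)
    {k : EuclideanSpace ℝ (Fin d) → ℝ} (hk : Integrable k (gauss d)) :
    |∫ y, z y * k y ∂(gauss d)| ≤ ∫ y, |k y| ∂(gauss d) := by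
  rw [← Real.norm_eq_abs]
  refine norm_integral_le_of_norm_le hk.abs (Eventually.of_forall fun y => ?_)
  rw [norm_mul]
  exact mul_le_of_le_one_left (norm_nonneg _) (hz.2 y)

lemma measurable_shiftQuad (v : EuclideanSpace ℝ (Fin d)) : Measurable (shiftQuad v) := by
  unfold shiftQuad; fun_prop

lemma measurable_ouLin {z : EuclideanSpace ℝ (Fin d) → ℝ} (hz : UnitBdd z)
    (v : EuclideanSpace ℝ (Fin d)) : Measurable (ouLin ρ z v) :=
  measurable_integral_mul hz.1 _ _ (by fun_prop)

lemma measurable_ouQuad {z : EuclideanSpace ℝ (Fin d) → ℝ} (hz : UnitBdd z)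
    (v : EuclideanSpace ℝ (Fin d)) : Measurable (ouQuad ρ z v) :=
  measurable_integral_mul hz.1 _ _ (measurable_shiftQuad v)

lemma abs_ouLin_le {z : EuclideanSpace ℝ (Fin d) → ℝ} (hz : UnitBdd z)
    (v x : EuclideanSpace ℝ (Fin d)) : |ouLin ρ z v x| ≤ ∫ y, |inner ℝ v y| ∂(gauss d) :=
  abs_integral_mul_le (hz.comp (by fun_prop)) (integrable_inner_gauss v)

lemma abs_ouQuad_le {z : EuclideanSpace ℝ (Fin d) → ℝ} (hz : UnitBdd z)
    (v x : EuclideanSpace ℝ (Fin d)) : |ouQuad ρ z v x| ≤ ∫ y, |shiftQuad v y| ∂(gauss d) :=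
  abs_integral_mul_le (hz.comp (by fun_prop)) (integrable_shiftQuad v)

lemma OU_expansion (hρ : ρ ^ 2 < 1) (v : EuclideanSpace ℝ (Fin d)) :
    ∃ C, ∀ z : EuclideanSpace ℝ (Fin d) → ℝ, UnitBdd z → ∀ x (τ κ : ℝ),
      κ = ρ / Real.sqrt (1 - ρ ^ 2) * τ → |κ| ≤ 1 →
      |OU d ρ z (x + τ • v) - (OU d ρ z x + κ * ouLin ρ z v x + κ ^ 2 * ouQuad ρ z v x)| ≤
        C * |κ| ^ 3 := by
  obtain ⟨C, hC⟩ := integral_mul_shiftDensity_expansion v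
  refine ⟨C, fun z hz x τ κ hκ hκ1 => ?_⟩
  have hz' := hz.comp (φ := fun y => ρ • x + Real.sqrt (1 - ρ ^ 2) • y) (by fun_prop)
  have h := hC _ hz'.1 1 hz'.2 κ hκ1
  rw [mul_one] at h
  rw [OU_add_smul d hρ, ← hκ]
  exact h

/-- The correlation of two functions translated along the direction `v`. -/
noncomputable def shiftCorr (v : EuclideanSpace ℝ (Fin d)) (w W : EuclideanSpace ℝ (Fin d) → ℝ)
    (s τ : ℝ) : ℝ :=
  ∫ x, w (x + s • v) * W (x + τ • v) ∂(gauss d)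

/-- A second-order expansion at the origin along every line, with polynomial coefficients. -/
def HasQuadExpansion (F : ℝ → ℝ → ℝ) (l₁ l₂ q₁₁ q₁₂ q₂₂ : ℝ) : Prop :=
  ∀ a b : ℝ, (fun t : ℝ => F (a * t) (b * t) - F 0 0 - t * (a * l₁ + b * l₂) -
    t ^ 2 * (a ^ 2 * q₁₁ + a * b * q₁₂ + b ^ 2 * q₂₂)) =O[𝓝 0] (fun t => t ^ 3)

lemma isBigO_cube_of_le {R : ℝ → ℝ} {C k : ℝ} (h : ∀ s, |s| ≤ 1 → |R s| ≤ C * |s| ^ 3) :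
    (fun t : ℝ => R (k * t)) =O[𝓝 0] (fun t => t ^ 3) := by
  refine Asymptotics.IsBigO.of_bound (C * |k| ^ 3) ?_
  have : Tendsto (fun t : ℝ => |k * t|) (𝓝 0) (𝓝 |k * 0|) := by
    apply Continuous.tendsto; fun_prop
  rw [mul_zero, abs_zero] at this
  filter_upwards [this.eventually (gt_mem_nhds one_pos)] with t ht
  have := h _ ht.le
  rw [Real.norm_eq_abs, Real.norm_eq_abs, abs_pow]
  rw [abs_mul] at this
  linarith

lemma isBigO_mul_cube {R S : ℝ → ℝ} (hR : ContinuousAt R 0)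
    (hS : S =O[𝓝 0] (fun t : ℝ => t ^ 3)) : (fun t : ℝ => R t * S t) =O[𝓝 0] (fun t => t ^ 3) := by
  have := (hR.tendsto.isBigO_one ℝ).mul hS
  simpa using this

lemma abs_mul_le_of_unitBdd {w V : EuclideanSpace ℝ (Fin d) → ℝ} (hw : UnitBdd w) {B : ℝ}
    (hV : ∀ x, |V x| ≤ B) (x : EuclideanSpace ℝ (Fin d)) : |w x * V x| ≤ B := by
  rw [abs_mul]
  exact (mul_le_of_le_one_left (abs_nonneg _) (hw.2 x)).trans (hV x)

lemma shiftCorr_eq (v : EuclideanSpace ℝ (Fin d)) (w W : EuclideanSpace ℝ (Fin d) → ℝ) (s τ : ℝ) :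
    shiftCorr v w W s τ =
      ∫ x, w x * W (x + (τ - s) • v) * shiftDensity (s • v) x ∂(gauss d) := by
  rw [← integral_gauss_add d (s • v) (fun x => w x * W (x + (τ - s) • v)), shiftCorr]
  congr 1 with x
  rw [add_assoc, ← add_smul, add_sub_cancel]

lemma hasQuadExpansion_shiftCorr (hρ : ρ ^ 2 < 1) (v : EuclideanSpace ℝ (Fin d))
    {w z : EuclideanSpace ℝ (Fin d) → ℝ} (hw : UnitBdd w) (hz : UnitBdd z) :
    ∃ q₁₁ q₁₂ q₂₂, HasQuadExpansion (shiftCorr v w (OU d ρ z))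
      (∫ x, w x * OU d ρ z x * inner ℝ v x ∂(gauss d) -
        ρ / Real.sqrt (1 - ρ ^ 2) * ∫ x, w x * ouLin ρ z v x ∂(gauss d))
      (ρ / Real.sqrt (1 - ρ ^ 2) * ∫ x, w x * ouLin ρ z v x ∂(gauss d)) q₁₁ q₁₂ q₂₂ := by
  set r := ρ / Real.sqrt (1 - ρ ^ 2) with hr
  obtain ⟨C, hC⟩ := integral_mul_shiftDensity_expansion v
  obtain ⟨C', hC'⟩ := OU_expansion hρ v
  have hW := hz.OU ρ
  have h0 := hC (fun x => w x * OU d ρ z x) (hw.1.mul hW.1) 1 (hw.mul hW).2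
  have h1 := hC (fun x => w x * ouLin ρ z v x) (hw.1.mul (measurable_ouLin hz v)) _
    (abs_mul_le_of_unitBdd hw (abs_ouLin_le hz v))
  have h2 := hC (fun x => w x * ouQuad ρ z v x) (hw.1.mul (measurable_ouQuad hz v)) _
    (abs_mul_le_of_unitBdd hw (abs_ouQuad_le hz v))
  have iV : ∀ V : EuclideanSpace ℝ (Fin d) → ℝ, Measurable V → ∀ B : ℝ, (∀ x, |V x| ≤ B) →
      ∀ s : ℝ, Integrable (fun x => w x * V x * shiftDensity (s • v) x) (gauss d) :=
    fun V hV B hB s => (integrable_shiftDensity (s • v)).bdd_mul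
      (hw.1.mul hV).aestronglyMeasurable
      (Eventually.of_forall fun x => (Real.norm_eq_abs _).trans_le
        (abs_mul_le_of_unitBdd hw hB x))
  have i0 := iV _ hW.1 1 hW.2
  have i1 := iV _ (measurable_ouLin (ρ := ρ) hz v) _ (abs_ouLin_le hz v)
  have i2 := iV _ (measurable_ouQuad (ρ := ρ) hz v) _ (abs_ouQuad_le hz v)
  set A00 := ∫ x, w x * OU d ρ z x ∂(gauss d)
  set A01 := ∫ x, w x * OU d ρ z x * inner ℝ v x ∂(gauss d)
  set A02 := ∫ x, w x * OU d ρ z x * shiftQuad v x ∂(gauss d)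
  set A10 := ∫ x, w x * ouLin ρ z v x ∂(gauss d)
  set A11 := ∫ x, w x * ouLin ρ z v x * inner ℝ v x ∂(gauss d)
  set A12 := ∫ x, w x * ouLin ρ z v x * shiftQuad v x ∂(gauss d)
  set A20 := ∫ x, w x * ouQuad ρ z v x ∂(gauss d)
  set A21 := ∫ x, w x * ouQuad ρ z v x * inner ℝ v x ∂(gauss d)
  set A22 := ∫ x, w x * ouQuad ρ z v x * shiftQuad v x ∂(gauss d)
  refine ⟨A02 - r * A11 + r ^ 2 * A20, r * A11 - 2 * r ^ 2 * A20, r ^ 2 * A20, fun a b => ?_⟩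
  set k := r * (b - a) with hk
  have key : (fun t : ℝ => shiftCorr v w (OU d ρ z) (a * t) (b * t) -
      (∫ x, w x * OU d ρ z x * shiftDensity ((a * t) • v) x ∂(gauss d) +
        (k * t) * ∫ x, w x * ouLin ρ z v x * shiftDensity ((a * t) • v) x ∂(gauss d) +
        (k * t) ^ 2 * ∫ x, w x * ouQuad ρ z v x * shiftDensity ((a * t) • v) x ∂(gauss d)))
      =O[𝓝 0] (fun t => t ^ 3) := by
    refine Asymptotics.IsBigO.of_bound (C' * |k| ^ 3) ?_
    have : Tendsto (fun t : ℝ => |k * t|) (𝓝 0) (𝓝 |k * 0|) := by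
      apply Continuous.tendsto; fun_prop
    rw [mul_zero, abs_zero] at this
    filter_upwards [this.eventually (gt_mem_nhds one_pos)] with t ht
    have j := iV (fun x => OU d ρ z (x + (b * t - a * t) • v)) (hW.1.comp (by fun_prop)) 1
      (fun x => hW.2 _) (a * t)
    have i4 : Integrable (fun x => w x * OU d ρ z x * shiftDensity ((a * t) • v) x +
        (k * t) * (w x * ouLin ρ z v x * shiftDensity ((a * t) • v) x)) (gauss d) :=
      (i0 _).add ((i1 _).const_mul _)
    have i5 : Integrable (fun x => w x * OU d ρ z x * shiftDensity ((a * t) • v) x +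
        (k * t) * (w x * ouLin ρ z v x * shiftDensity ((a * t) • v) x) +
        (k * t) ^ 2 * (w x * ouQuad ρ z v x * shiftDensity ((a * t) • v) x)) (gauss d) :=
      i4.add ((i2 _).const_mul _)
    rw [shiftCorr_eq, ← integral_const_mul, ← integral_const_mul,
      ← integral_add (i0 _) ((i1 _).const_mul _), ← integral_add i4 ((i2 _).const_mul _),
      ← integral_sub j i5]
    have hb : C' * |k| ^ 3 * ‖t ^ 3‖ =
        ∫ x, C' * |k * t| ^ 3 * shiftDensity ((a * t) • v) x ∂(gauss d) := by
      rw [integral_const_mul, integral_shiftDensity, Real.norm_eq_abs, abs_pow, abs_mul k t]; ring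
    rw [hb]
    refine norm_integral_le_of_norm_le ((integrable_shiftDensity _).const_mul _)
      (Eventually.of_forall fun x => ?_)
    have e := hC' z hz x (b * t - a * t) (k * t) (by rw [hk, hr]; ring) ht.le
    have e2 : w x * OU d ρ z (x + (b * t - a * t) • v) * shiftDensity ((a * t) • v) x -
        (w x * OU d ρ z x * shiftDensity ((a * t) • v) x +
        (k * t) * (w x * ouLin ρ z v x * shiftDensity ((a * t) • v) x) +
        (k * t) ^ 2 * (w x * ouQuad ρ z v x * shiftDensity ((a * t) • v) x)) =
        w x * (OU d ρ z (x + (b * t - a * t) • v) - (OU d ρ z x + (k * t) * ouLin ρ z v x +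
          (k * t) ^ 2 * ouQuad ρ z v x)) * shiftDensity ((a * t) • v) x := by ring
    have e3 : 0 ≤ shiftDensity ((a * t) • v) x := (Real.exp_pos _).le
    rw [e2, norm_mul, norm_mul, Real.norm_of_nonneg e3]
    refine mul_le_mul_of_nonneg_right ?_ e3
    exact (mul_le_of_le_one_left (norm_nonneg _) (hw.2 x)).trans e
  have c0 := isBigO_cube_of_le (k := a) h0
  have c1 := isBigO_mul_cube (R := fun t => k * t) (by fun_prop) (isBigO_cube_of_le (k := a) h1)
  have c2 := isBigO_mul_cube (R := fun t => (k * t) ^ 2) (by fun_prop)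
    (isBigO_cube_of_le (k := a) h2)
  have c3 := isBigO_mul_cube (R := fun t => k * a ^ 2 * A12 + k ^ 2 * a * A21 +
    t * (k ^ 2 * a ^ 2 * A22)) (by fun_prop) (Asymptotics.isBigO_refl (fun t : ℝ => t ^ 3) (𝓝 0))
  have hF0 : shiftCorr v w (OU d ρ z) 0 0 = A00 := by simp [shiftCorr, A00]
  refine ((((key.add c0).add c1).add c2).add c3).congr_left fun t => ?_
  rw [hF0]
  ring

end OUExpansion

section WeakCompactness

variable {d m : ℕ} {ρ : ℝ}

lemma abs_le_one_of_mem_stdSimplex {a : Fin m → ℝ} (ha : a ∈ stdSimplex ℝ (Fin m)) (i : Fin m) :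
    |a i| ≤ 1 := by
  rw [abs_of_nonneg (ha.1 i), ← ha.2]
  exact Finset.single_le_sum (fun j _ => ha.1 j) (Finset.mem_univ i)

lemma SimplexMap.unitBdd {f : EuclideanSpace ℝ (Fin d) → Fin m → ℝ} (hf : SimplexMap d m f)
    (i : Fin m) : UnitBdd (fun x => f x i) :=
  ⟨(measurable_pi_apply i).comp hf.1, fun x => abs_le_one_of_mem_stdSimplex (hf.2 x) i⟩

/-- Weak convergence of vector-valued functions, tested against bounded measurable functions. -/
def WeakTendsto (f : ℕ → EuclideanSpace ℝ (Fin d) → Fin m → ℝ)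
    (F : EuclideanSpace ℝ (Fin d) → Fin m → ℝ) : Prop :=
  ∀ (w : EuclideanSpace ℝ (Fin d) → ℝ) (B : ℝ), Measurable w → (∀ x, |w x| ≤ B) → ∀ i,
    Tendsto (fun k => ∫ x, f k x i * w x ∂(gauss d)) atTop (𝓝 (∫ x, F x i * w x ∂(gauss d)))

lemma norm_toLp_le_of_mem_stdSimplex {a : Fin m → ℝ} (ha : a ∈ stdSimplex ℝ (Fin m)) :
    ‖WithLp.toLp 2 a‖ ≤ 1 := by
  rw [EuclideanSpace.norm_eq, Real.sqrt_le_iff]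
  refine ⟨zero_le_one, ?_⟩
  rw [one_pow, ← ha.2]
  refine Finset.sum_le_sum fun i _ => ?_
  have h := abs_le_one_of_mem_stdSimplex ha i
  rw [Real.norm_eq_abs, sq_abs]
  have h0 := ha.1 i
  rw [abs_of_nonneg h0] at h
  nlinarith

lemma exists_weak_limit_L2 {f : ℕ → EuclideanSpace ℝ (Fin d) → Fin m → ℝ}
    (hf : ∀ k, SimplexMap d m (f k)) :
    ∃ φ : ℕ → ℕ, StrictMono φ ∧ ∃ F : EuclideanSpace ℝ (Fin d) → Fin m → ℝ, Measurable F ∧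
      (∀ i, Integrable (fun x => F x i) (gauss d)) ∧ WeakTendsto (fun k => f (φ k)) F := by
  have hmem : ∀ k, MemLp (fun x => WithLp.toLp 2 (f k x)) 2 (gauss d) := fun k =>
    MemLp.of_bound (((WithLp.measurable_toLp 2 (Fin m → ℝ)).comp (hf k).1).aestronglyMeasurable) 1
      (Eventually.of_forall fun x => norm_toLp_le_of_mem_stdSimplex ((hf k).2 x))
  let u : ℕ → Lp (EuclideanSpace ℝ (Fin m)) 2 (gauss d) := fun k => (hmem k).toLp _
  have hu : ∀ k, ‖u k‖ ≤ 1 := by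
    intro k
    have := Lp.norm_le_of_ae_bound (p := 2) (f := u k) (C := 1) zero_le_one (by
      filter_upwards [(hmem k).coeFn_toLp] with x hx
      rw [hx]; exact norm_toLp_le_of_mem_stdSimplex ((hf k).2 x))
    simpa [measureUnivNNReal] using this
  have hd : ∀ k, StrongDual.toWeakDual (InnerProductSpace.toDual ℝ _ (u k)) ∈
      WeakDual.toStrongDual ⁻¹' Metric.closedBall
        (0 : StrongDual ℝ (Lp (EuclideanSpace ℝ (Fin m)) 2 (gauss d))) 1 := by
    intro k
    simpa using hu k
  have : Fact ((2 : ENNReal) ≠ ⊤) := ⟨by simp⟩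
  obtain ⟨a, -, φ, hφ, ha⟩ := WeakDual.isSeqCompact_closedBall ℝ
    (Lp (EuclideanSpace ℝ (Fin m)) 2 (gauss d)) 0 1 hd
  refine ⟨φ, hφ, ?_⟩
  set G := (InnerProductSpace.toDual ℝ _).symm (WeakDual.toStrongDual a) with hG
  refine ⟨fun x => WithLp.ofLp (G x), ?_, ?_, ?_⟩
  · exact (WithLp.measurable_ofLp 2 (Fin m → ℝ)).comp (Lp.stronglyMeasurable G).measurable
  · intro i
    have h1 : Integrable G (gauss d) := (Lp.memLp G).integrable (by norm_num)
    exact h1.eval_piLp i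
  · intro w B hw hB i
    have hwm : MemLp (fun x => w x • EuclideanSpace.single i (1 : ℝ)) 2 (gauss d) := by
      refine MemLp.of_bound (hw.smul_const _).aestronglyMeasurable B
        (Eventually.of_forall fun x => ?_)
      rw [norm_smul]; simpa using hB x
    have hin : ∀ g : Lp (EuclideanSpace ℝ (Fin m)) 2 (gauss d),
        inner ℝ g (hwm.toLp _) = ∫ x, WithLp.ofLp (g x) i * w x ∂(gauss d) := by
      intro g
      rw [L2.inner_def]
      refine integral_congr_ae ?_
      filter_upwards [hwm.coeFn_toLp] with x hx
      rw [hx, inner_smul_right, EuclideanSpace.inner_single_right]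
      simp [mul_comm]
    have ht := ((WeakDual.eval_continuous (𝕜 := ℝ) (hwm.toLp _)).tendsto a).comp ha
    have e1 : a (hwm.toLp _) = inner ℝ G (hwm.toLp _) := by
      rw [hG]
      exact (InnerProductSpace.toDual_symm_apply).symm
    rw [e1, hin] at ht
    refine ht.congr fun k => ?_
    have e2 : (StrongDual.toWeakDual (InnerProductSpace.toDual ℝ _ (u (φ k)))) (hwm.toLp _) =
        inner ℝ (u (φ k)) (hwm.toLp _) := rfl
    rw [Function.comp_apply, Function.comp_apply, e2, hin]
    refine integral_congr_ae ?_
    filter_upwards [(hmem (φ k)).coeFn_toLp] with x hx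
    rw [hx]

lemma WeakTendsto.setIntegral {f : ℕ → EuclideanSpace ℝ (Fin d) → Fin m → ℝ}
    {F : EuclideanSpace ℝ (Fin d) → Fin m → ℝ} (h : WeakTendsto f F)
    {s : Set (EuclideanSpace ℝ (Fin d))} (hs : MeasurableSet s) (i : Fin m) :
    Tendsto (fun k => ∫ x in s, f k x i ∂(gauss d)) atTop (𝓝 (∫ x in s, F x i ∂(gauss d))) := by
  have e : ∀ g : EuclideanSpace ℝ (Fin d) → ℝ,
      ∫ x in s, g x ∂(gauss d) = ∫ x, g x * s.indicator 1 x ∂(gauss d) := by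
    intro g
    rw [← integral_indicator hs]
    refine integral_congr_ae (Eventually.of_forall fun x => ?_)
    by_cases hx : x ∈ s <;> simp [hx]
  simp only [e]
  refine h _ 1 (measurable_one.indicator hs) (fun x => ?_) i
  by_cases hx : x ∈ s <;> simp [hx]

lemma WeakTendsto.congr_ae {f : ℕ → EuclideanSpace ℝ (Fin d) → Fin m → ℝ}
    {F G : EuclideanSpace ℝ (Fin d) → Fin m → ℝ} (h : WeakTendsto f F) (hFG : F =ᵐ[gauss d] G) :
    WeakTendsto f G := by
  intro w B hw hB i
  rw [← integral_congr_ae (hFG.mono fun x hx => by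
    show F x i * w x = G x i * w x
    rw [hx])]
  exact h w B hw hB i

/-- Weak sequential compactness of the set of simplex-valued maps. -/
lemma exists_weakTendsto_subseq {f : ℕ → EuclideanSpace ℝ (Fin d) → Fin m → ℝ}
    (hf : ∀ k, SimplexMap d m (f k)) :
    ∃ φ : ℕ → ℕ, StrictMono φ ∧ ∃ F, SimplexMap d m F ∧ WeakTendsto (fun k => f (φ k)) F := by
  obtain ⟨φ, hφ, F, hFm, hFi, hF⟩ := exists_weak_limit_L2 hf
  have h0 : ∀ i, ∀ᵐ x ∂(gauss d), 0 ≤ F x i := fun i =>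
    ae_nonneg_of_forall_setIntegral_nonneg (hFi i) fun s hs _ =>
      ge_of_tendsto' (hF.setIntegral hs i) fun k => integral_nonneg fun x => ((hf _).2 x).1 i
  have h1 : (fun x => ∑ i, F x i) =ᵐ[gauss d] fun _ => 1 := by
    refine Integrable.ae_eq_of_forall_setIntegral_eq _ _ (integrable_finsetSum _ fun i _ => hFi i)
      (integrable_const _) fun s hs _ => ?_
    rw [integral_finsetSum _ fun i _ => (hFi i).integrableOn]
    refine tendsto_nhds_unique (tendsto_finsetSum _ fun i _ => hF.setIntegral hs i)
      (tendsto_const_nhds.congr fun k => ?_)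
    rw [← integral_finsetSum _ fun i _ => ((hf _).unitBdd i).integrable.integrableOn]
    exact integral_congr_ae (Eventually.of_forall fun x => ((hf _).2 x).2.symm)
  have hS : MeasurableSet {x | F x ∈ stdSimplex ℝ (Fin m)} :=
    hFm (isClosed_stdSimplex ℝ (Fin m)).measurableSet
  classical
  refine ⟨φ, hφ, fun x => if F x ∈ stdSimplex ℝ (Fin m) then F x else f 0 0,
    ⟨Measurable.ite hS hFm measurable_const, fun x => ?_⟩, hF.congr_ae ?_⟩
  · dsimp only
    split_ifs with h
    exacts [h, (hf 0).2 0]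
  · filter_upwards [ae_all_iff.2 h0, h1] with x hx0 hx1
    rw [if_pos ⟨hx0, hx1⟩]

lemma WeakTendsto.comp {f : ℕ → EuclideanSpace ℝ (Fin d) → Fin m → ℝ}
    {F : EuclideanSpace ℝ (Fin d) → Fin m → ℝ} (h : WeakTendsto f F) {φ : ℕ → ℕ}
    (hφ : StrictMono φ) : WeakTendsto (fun k => f (φ k)) F :=
  fun w B hw hB i => (h w B hw hB i).comp hφ.tendsto_atTop

lemma WeakTendsto.tendsto_OU (hρ : ρ ^ 2 < 1) {f : ℕ → EuclideanSpace ℝ (Fin d) → Fin m → ℝ}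
    {F : EuclideanSpace ℝ (Fin d) → Fin m → ℝ} (h : WeakTendsto f F) (i : Fin m)
    (x : EuclideanSpace ℝ (Fin d)) :
    Tendsto (fun k => OU d ρ (fun y => f k y i) x) atTop (𝓝 (OU d ρ (fun y => F y i) x)) := by
  simp only [OU_eq_mehler d hρ]
  obtain ⟨C, hC⟩ := mehler_le d hρ x
  refine h _ C ?_ (fun y => ?_) i
  · exact ((continuous_mehler d ρ).comp (by fun_prop : Continuous fun y => (x, y))).measurable
  · rw [abs_of_nonneg (mehler_nonneg d ρ x y)]; exact hC y

lemma tendsto_integral_of_unitBdd {u : ℕ → EuclideanSpace ℝ (Fin d) → ℝ}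
    {U : EuclideanSpace ℝ (Fin d) → ℝ} (hu : ∀ k, UnitBdd (u k))
    (h : ∀ x, Tendsto (fun k => u k x) atTop (𝓝 (U x))) :
    Tendsto (fun k => ∫ x, u k x ∂(gauss d)) atTop (𝓝 (∫ x, U x ∂(gauss d))) :=
  tendsto_integral_of_dominated_convergence (fun _ => 1)
    (fun k => (hu k).1.aestronglyMeasurable) (integrable_const _)
    (fun k => Eventually.of_forall (hu k).2) (Eventually.of_forall h)

lemma WeakTendsto.tendsto_integral_OU_sq (hρ : ρ ^ 2 < 1)
    {g : ℕ → EuclideanSpace ℝ (Fin d) → Fin m → ℝ} {G : EuclideanSpace ℝ (Fin d) → Fin m → ℝ}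
    (hg : ∀ k, SimplexMap d m (g k)) (h : WeakTendsto g G) (j : Fin m) :
    Tendsto (fun k => ∫ x, OU d ρ (fun y => g k y j) x * OU d ρ (fun y => g k y j) x ∂(gauss d))
      atTop (𝓝 (∫ x, OU d ρ (fun y => G y j) x * OU d ρ (fun y => G y j) x ∂(gauss d))) :=
  tendsto_integral_of_unitBdd
    (fun k => (((hg k).unitBdd j).OU ρ).mul (((hg k).unitBdd j).OU ρ))
    fun x => (h.tendsto_OU hρ j x).mul (h.tendsto_OU hρ j x)

lemma WeakTendsto.tendsto_Cmat (hρ : ρ ^ 2 < 1)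
    {f g : ℕ → EuclideanSpace ℝ (Fin d) → Fin m → ℝ} {F G : EuclideanSpace ℝ (Fin d) → Fin m → ℝ}
    (hf : ∀ k, SimplexMap d m (f k)) (hg : ∀ k, SimplexMap d m (g k)) (hG : SimplexMap d m G)
    (hF' : WeakTendsto f F) (hG' : WeakTendsto g G) (i j : Fin m) :
    Tendsto (fun k => Cmat d m ρ (f k) (g k) i j) atTop (𝓝 (Cmat d m ρ F G i j)) := by
  have hGb := (hG.unitBdd j).OU ρ
  have h1 := hF' (OU d ρ fun y => G y j) 1 hGb.1 hGb.2 i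
  have h2 : Tendsto (fun k => ∫ x, (OU d ρ (fun y => g k y j) x - OU d ρ (fun y => G y j) x) *
      f k x i ∂(gauss d)) atTop (𝓝 (∫ _, (0 : ℝ) ∂(gauss d))) := by
    refine tendsto_integral_of_dominated_convergence (fun _ => 2) (fun k => ?_)
      (integrable_const _) (fun k => Eventually.of_forall fun x => ?_)
      (Eventually.of_forall fun x => ?_)
    · exact (((((hg k).unitBdd j).OU ρ).1.sub hGb.1).mul
        ((hf k).unitBdd i).1).aestronglyMeasurable
    · rw [norm_mul]
      have a1 := (((hg k).unitBdd j).OU ρ).2 x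
      have a2 := hGb.2 x
      have a3 := ((hf k).unitBdd i).2 x
      calc _ ≤ (2 : ℝ) * 1 := mul_le_mul ((abs_sub _ _).trans (by linarith)) a3
            (abs_nonneg _) zero_le_two
        _ = 2 := mul_one _
    · have t0 : Tendsto (fun k => OU d ρ (fun y => g k y j) x - OU d ρ (fun y => G y j) x) atTop
          (𝓝 0) := by
        simpa using (hG'.tendsto_OU hρ j x).sub_const (OU d ρ (fun y => G y j) x)
      exact t0.zero_mul_isBoundedUnder_le
        (isBoundedUnder_of ⟨1, fun k => ((hf k).unitBdd i).2 x⟩)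
  have h3 := h1.add h2
  rw [integral_zero, add_zero] at h3
  refine h3.congr fun k => ?_
  have b1 := (((hf k).unitBdd i).mul hGb).integrable
  have b2 := (((hf k).unitBdd i).mul (((hg k).unitBdd j).OU ρ)).integrable
  rw [← integral_add b1]
  · exact integral_congr_ae (Eventually.of_forall fun x => by dsimp only; ring)
  · exact (b2.sub b1).congr (Eventually.of_forall fun x => by simp; ring)

lemma exists_weakTendsto_subseq_pair {f g : ℕ → EuclideanSpace ℝ (Fin d) → Fin m → ℝ}
    (hf : ∀ k, SimplexMap d m (f k)) (hg : ∀ k, SimplexMap d m (g k)) :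
    ∃ φ : ℕ → ℕ, StrictMono φ ∧ ∃ F G, SimplexMap d m F ∧ SimplexMap d m G ∧
      WeakTendsto (fun k => f (φ k)) F ∧ WeakTendsto (fun k => g (φ k)) G := by
  obtain ⟨φ, hφ, F, hF, hfF⟩ := exists_weakTendsto_subseq hf
  obtain ⟨ψ, hψ, G, hG, hgG⟩ := exists_weakTendsto_subseq fun k => hg (φ k)
  exact ⟨φ ∘ ψ, hφ.comp hψ, F, G, hF, hG, hfF.comp hψ, hgG⟩

lemma isClosed_Sset (hρ : ρ ^ 2 < 1) (m d : ℕ) : IsClosed (Sset ρ m d) := by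
  have : SequentialSpace (Matrix (Fin m) (Fin m) ℝ) :=
    inferInstanceAs (SequentialSpace (Fin m → Fin m → ℝ))
  refine IsSeqClosed.isClosed fun M M₀ hM hlim => ?_
  choose f g hf hg hfg using hM
  obtain ⟨φ, hφ, F, G, hF, hG, hfF, hgG⟩ := exists_weakTendsto_subseq_pair hf hg
  refine ⟨F, G, hF, hG, ?_⟩
  ext i j
  have h1 := hfF.tendsto_Cmat hρ (fun k => hf (φ k)) (fun k => hg (φ k)) hG hgG i j
  have h2 : Tendsto (fun k => M (φ k) i j) atTop (𝓝 (M₀ i j)) :=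
    (tendsto_pi_nhds.1 ((tendsto_pi_nhds.1 hlim) i) j).comp hφ.tendsto_atTop
  simp only [hfg] at h2
  exact tendsto_nhds_unique h2 h1

end WeakCompactness

section Dimension

variable {n d m : ℕ} {ρ : ℝ}

lemma map_isometry_gauss (U : EuclideanSpace ℝ (Fin d) ≃ₗᵢ[ℝ] EuclideanSpace ℝ (Fin d)) :
    (gauss d).map U = gauss d := by
  rw [gauss_eq_stdGaussian, stdGaussian_map]

lemma integral_gauss_comp_isometry
    (U : EuclideanSpace ℝ (Fin d) ≃ₗᵢ[ℝ] EuclideanSpace ℝ (Fin d))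
    (F : EuclideanSpace ℝ (Fin d) → ℝ) : ∫ x, F (U x) ∂(gauss d) = ∫ x, F x ∂(gauss d) := by
  conv_rhs => rw [← map_isometry_gauss U]
  exact (integral_map_equiv U.toMeasurableEquiv F).symm

lemma OU_comp_isometry (U : EuclideanSpace ℝ (Fin d) ≃ₗᵢ[ℝ] EuclideanSpace ℝ (Fin d))
    (g : EuclideanSpace ℝ (Fin d) → ℝ) (x : EuclideanSpace ℝ (Fin d)) :
    OU d ρ (fun y => g (U y)) x = OU d ρ g (U x) := by
  unfold OU
  rw [← integral_gauss_comp_isometry U fun y => g (ρ • U x + √(1 - ρ ^ 2) • y)]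
  simp

lemma Cmat_comp_isometry (U : EuclideanSpace ℝ (Fin d) ≃ₗᵢ[ℝ] EuclideanSpace ℝ (Fin d))
    (f g : EuclideanSpace ℝ (Fin d) → Fin m → ℝ) :
    Cmat d m ρ (fun x => f (U x)) (fun x => g (U x)) = Cmat d m ρ f g := by
  ext i j
  simp only [Cmat, Matrix.of_apply]
  simp only [OU_comp_isometry U fun y => g y j]
  exact integral_gauss_comp_isometry U fun x => f x i * OU d ρ (fun y => g y j) x

lemma SimplexMap.comp {f : EuclideanSpace ℝ (Fin d) → Fin m → ℝ} (hf : SimplexMap d m f)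
    {φ : EuclideanSpace ℝ (Fin n) → EuclideanSpace ℝ (Fin d)} (hφ : Measurable φ) :
    SimplexMap n m (fun x => f (φ x)) :=
  ⟨hf.1.comp hφ, fun x => hf.2 (φ x)⟩

lemma OU_neg_comp_neg (g : EuclideanSpace ℝ (Fin d) → ℝ) (x : EuclideanSpace ℝ (Fin d)) :
    OU d (-ρ) (fun y => g (-y)) x = OU d ρ g x := by
  unfold OU
  rw [← integral_gauss_comp_isometry (LinearIsometryEquiv.neg ℝ)
    fun y => g (ρ • x + √(1 - ρ ^ 2) • y)]
  simp [add_comm]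

lemma Sset_neg_subset (ρ : ℝ) (m d : ℕ) : Sset ρ m d ⊆ Sset (-ρ) m d := by
  rintro M ⟨f, g, hf, hg, rfl⟩
  refine ⟨f, fun x => g (-x), hf, hg.comp measurable_neg, ?_⟩
  ext i j
  simp only [Cmat, Matrix.of_apply, OU_neg_comp_neg fun y => g y j]

lemma Sset_neg (ρ : ℝ) (m d : ℕ) : Sset (-ρ) m d = Sset ρ m d :=
  (by simpa using Sset_neg_subset (-ρ) m d : Sset (-ρ) m d ⊆ Sset ρ m d).antisymm
    (Sset_neg_subset ρ m d)

/-- Prepend a coordinate to a Euclidean vector. -/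
noncomputable def consE (p : ℝ × EuclideanSpace ℝ (Fin n)) : EuclideanSpace ℝ (Fin (n + 1)) :=
  WithLp.toLp 2 (Fin.cons p.1 (WithLp.ofLp p.2) : Fin (n + 1) → ℝ)

/-- Forget the first coordinate of a Euclidean vector. -/
noncomputable def tailE (x : EuclideanSpace ℝ (Fin (n + 1))) : EuclideanSpace ℝ (Fin n) :=
  WithLp.toLp 2 (fun i => x i.succ)

@[simp] lemma tailE_consE (p : ℝ × EuclideanSpace ℝ (Fin n)) : tailE (consE p) = p.2 := by
  ext i; simp [tailE, consE]

lemma consE_linear (a b : ℝ) (p q : ℝ × EuclideanSpace ℝ (Fin n)) :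
    a • consE p + b • consE q = consE (a • p + b • q) := by
  ext i
  refine Fin.cases ?_ (fun j => ?_) i <;> simp [consE]

@[fun_prop] lemma measurable_consE : Measurable (consE (n := n)) := by
  refine (WithLp.measurable_toLp 2 (Fin (n + 1) → ℝ)).comp (measurable_pi_iff.2 fun i => ?_)
  refine Fin.cases ?_ (fun j => ?_) i
  · simpa using measurable_fst
  · simp only [Fin.cons_succ]; fun_prop

@[fun_prop] lemma measurable_tailE : Measurable (tailE (n := n)) := by
  refine (WithLp.measurable_toLp 2 (Fin n → ℝ)).comp (measurable_pi_iff.2 fun i => ?_)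
  fun_prop

lemma map_consE : ((gaussianReal 0 1).prod (gauss n)).map consE = gauss (n + 1) := by
  have h := (measurePreserving_piFinSuccAbove (fun _ : Fin (n + 1) => gaussianReal 0 1) 0).symm
  have h2 : MeasurePreserving (WithLp.toLp 2 : (Fin n → ℝ) → EuclideanSpace ℝ (Fin n))
      (Measure.pi fun _ => gaussianReal 0 1) (gauss n) :=
    ⟨WithLp.measurable_toLp 2 _, by rw [gauss_eq_stdGaussian, map_pi_eq_stdGaussian]⟩
  rw [gauss_eq_stdGaussian (n + 1), ← map_pi_eq_stdGaussian, ← h.map_eq, ← h2.map_eq,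
    ← Measure.map_id (μ := gaussianReal 0 1),
    Measure.map_prod_map _ _ measurable_id h2.measurable, Measure.map_id,
    Measure.map_map measurable_consE (measurable_id.prodMap h2.measurable),
    Measure.map_map (WithLp.measurable_toLp 2 _) h.measurable]
  congr 1
  ext p i
  refine Fin.cases ?_ (fun j => ?_) i <;> simp [consE, MeasurableEquiv.piFinSuccAbove]

lemma integral_gauss_succ {F : EuclideanSpace ℝ (Fin (n + 1)) → ℝ} (hF : UnitBdd F) :
    ∫ x, F x ∂(gauss (n + 1)) = ∫ x, ∫ z, F (consE (z, x)) ∂(gaussianReal 0 1) ∂(gauss n) := by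
  rw [← map_consE, integral_map measurable_consE.aemeasurable hF.1.aestronglyMeasurable,
    integral_prod_symm]
  exact Integrable.of_bound (hF.1.comp measurable_consE).aestronglyMeasurable 1
    (Eventually.of_forall fun p => hF.2 _)

lemma OU_succ_consE {g : EuclideanSpace ℝ (Fin (n + 1)) → ℝ} (hg : UnitBdd g)
    (z : ℝ) (x : EuclideanSpace ℝ (Fin n)) :
    OU (n + 1) ρ g (consE (z, x)) = ∫ y, ∫ w, g (consE (ρ * z + √(1 - ρ ^ 2) * w,
      ρ • x + √(1 - ρ ^ 2) • y)) ∂(gaussianReal 0 1) ∂(gauss n) := by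
  unfold OU
  rw [integral_gauss_succ (hg.comp (φ := fun y => ρ • consE (z, x) + √(1 - ρ ^ 2) • y) (by fun_prop))]
  simp [consE_linear]

lemma Sset_subset_succ (ρ : ℝ) (m n : ℕ) : Sset ρ m n ⊆ Sset ρ m (n + 1) := by
  rintro M ⟨f, g, hf, hg, rfl⟩
  have hf' := hf.comp (measurable_tailE (n := n))
  have hg' := hg.comp (measurable_tailE (n := n))
  refine ⟨_, _, hf', hg', ?_⟩
  ext i j
  simp only [Cmat, Matrix.of_apply]
  rw [integral_gauss_succ ((hf'.unitBdd i).mul ((hg'.unitBdd j).OU ρ))]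
  simp only [OU_succ_consE (hg'.unitBdd j)]
  simp [OU]

lemma integral_gaussianReal_rotate (hρ : ρ ^ 2 < 1) {F : ℝ → ℝ} (hF : Measurable F) :
    ∫ p : ℝ × ℝ, F (ρ * p.1 + √(1 - ρ ^ 2) * p.2) ∂((gaussianReal 0 1).prod (gaussianReal 0 1)) =
      ∫ z, F z ∂(gaussianReal 0 1) := by
  have h1 : ((gaussianReal 0 1).prod (gaussianReal 0 1)).map
      (fun p : ℝ × ℝ => ρ * p.1 + √(1 - ρ ^ 2) * p.2) = gaussianReal 0 1 := by
    have e : (fun p : ℝ × ℝ => ρ * p.1 + √(1 - ρ ^ 2) * p.2) =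
      (fun p : ℝ × ℝ => p.1 + p.2) ∘ Prod.map (ρ * ·) (√(1 - ρ ^ 2) * ·) := rfl
    rw [e, ← Measure.map_map (by fun_prop) (by fun_prop), ← Measure.map_prod_map _ _
      (by fun_prop) (by fun_prop), gaussianReal_map_const_mul, gaussianReal_map_const_mul]
    have := gaussianReal_conv_gaussianReal (m₁ := ρ * 0) (m₂ := √(1 - ρ ^ 2) * 0)
      (v₁ := NNReal.mk (ρ ^ 2) (sq_nonneg _) * 1) (v₂ := NNReal.mk (√(1 - ρ ^ 2) ^ 2) (sq_nonneg _) * 1)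
    rw [Measure.conv] at this
    rw [this]
    congr 1
    · simp
    · ext
      simp [Real.sq_sqrt (by linarith : 0 ≤ 1 - ρ ^ 2)]
  conv_rhs => rw [← h1]
  rw [integral_map (by fun_prop) hF.aestronglyMeasurable]

/-- Averaging a simplex-valued map over the first coordinate. -/
noncomputable def avgFst (f : EuclideanSpace ℝ (Fin (n + 1)) → Fin m → ℝ)
    (x : EuclideanSpace ℝ (Fin n)) (i : Fin m) : ℝ :=
  ∫ z, f (consE (z, x)) i ∂(gaussianReal 0 1)

lemma integrable_comp_consE {g : EuclideanSpace ℝ (Fin (n + 1)) → ℝ} (hg : UnitBdd g)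
    (x : EuclideanSpace ℝ (Fin n)) :
    Integrable (fun z => g (consE (z, x))) (gaussianReal 0 1) :=
  Integrable.of_bound (hg.1.comp (by fun_prop)).aestronglyMeasurable 1
    (Eventually.of_forall fun p => hg.2 _)

lemma SimplexMap.avgFst {f : EuclideanSpace ℝ (Fin (n + 1)) → Fin m → ℝ}
    (hf : SimplexMap (n + 1) m f) : SimplexMap n m (avgFst f) := by
  refine ⟨measurable_pi_iff.2 fun i => ?_, fun x => ⟨fun i => ?_, ?_⟩⟩
  · exact (((hf.unitBdd i).1.comp measurable_consE).stronglyMeasurable.integral_prod_left').measurable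
  · exact integral_nonneg fun z => (hf.2 _).1 i
  · unfold _root_.avgFst
    rw [← integral_finsetSum _ fun i _ => integrable_comp_consE (hf.unitBdd i) x]
    simp [(hf.2 _).2]

lemma integral_OU_succ (hρ : ρ ^ 2 < 1) {g : EuclideanSpace ℝ (Fin (n + 1)) → ℝ} (hg : UnitBdd g)
    (x : EuclideanSpace ℝ (Fin n)) :
    ∫ z, OU (n + 1) ρ g (consE (z, x)) ∂(gaussianReal 0 1) =
      OU n ρ (fun y => ∫ z, g (consE (z, y)) ∂(gaussianReal 0 1)) x := by
  simp only [OU_succ_consE hg]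
  have hm : Measurable (fun p : ℝ × EuclideanSpace ℝ (Fin n) × ℝ =>
      g (consE (ρ * p.1 + √(1 - ρ ^ 2) * p.2.2, ρ • x + √(1 - ρ ^ 2) • p.2.1))) :=
    hg.1.comp (by fun_prop)
  rw [integral_integral_swap]
  · unfold OU
    refine integral_congr_ae (Eventually.of_forall fun y => ?_)
    dsimp only
    rw [← integral_gaussianReal_rotate hρ (F := fun z => g (consE (z, ρ • x + √(1 - ρ ^ 2) • y)))
      (hg.1.comp (by fun_prop)), integral_prod]
    exact Integrable.of_bound (hg.1.comp (by fun_prop)).aestronglyMeasurable 1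
      (Eventually.of_forall fun p => hg.2 _)
  · refine Integrable.of_bound (C := 1) (StronglyMeasurable.aestronglyMeasurable ?_)
      (Eventually.of_forall fun p => ?_)
    · have : Measurable (fun q : (ℝ × EuclideanSpace ℝ (Fin n)) × ℝ =>
          g (consE (ρ * q.1.1 + √(1 - ρ ^ 2) * q.2, ρ • x + √(1 - ρ ^ 2) • q.1.2))) :=
        hg.1.comp (by fun_prop)
      exact this.stronglyMeasurable.integral_prod_right'
    · refine (norm_integral_le_of_norm_le (integrable_const 1)
        (Eventually.of_forall fun w => hg.2 _)).trans ?_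
      simp

lemma Cmat_mem_Sset_of_const_fst (hρ : ρ ^ 2 < 1)
    {f g : EuclideanSpace ℝ (Fin (n + 1)) → Fin m → ℝ}
    (hf : SimplexMap (n + 1) m f) (hg : SimplexMap (n + 1) m g)
    (h : ∀ j z x, OU (n + 1) ρ (fun y => g y j) (consE (z, x)) =
      OU (n + 1) ρ (fun y => g y j) (consE (0, x))) :
    Cmat (n + 1) m ρ f g ∈ Sset ρ m n := by
  refine ⟨_, _, hf.avgFst, hg.avgFst, ?_⟩
  ext i j
  simp only [Cmat, Matrix.of_apply]
  rw [integral_gauss_succ ((hf.unitBdd i).mul ((hg.unitBdd j).OU ρ))]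
  refine integral_congr_ae (Eventually.of_forall fun x => ?_)
  dsimp only
  have e := integral_OU_succ hρ (hg.unitBdd j) x
  simp only [h j _ x] at e ⊢
  rw [integral_const, probReal_univ, one_smul] at e
  rw [integral_mul_const, e]
  rfl

/-- If the noise-smoothed map is invariant in one direction, one dimension can be dropped. -/
lemma Cmat_mem_Sset_of_invariant (hρ : ρ ^ 2 < 1)
    {f g : EuclideanSpace ℝ (Fin (n + 1)) → Fin m → ℝ}
    (hf : SimplexMap (n + 1) m f) (hg : SimplexMap (n + 1) m g)
    {v : EuclideanSpace ℝ (Fin (n + 1))} (hv : v ≠ 0)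
    (h : ∀ j x (t : ℝ), OU (n + 1) ρ (fun y => g y j) (x + t • v) =
      OU (n + 1) ρ (fun y => g y j) x) :
    Cmat (n + 1) m ρ f g ∈ Sset ρ m n := by
  set e : EuclideanSpace ℝ (Fin (n + 1)) := consE (1, 0) with he
  have hen : ‖e‖ = 1 := by
    have : e = EuclideanSpace.single 0 1 := by
      ext i
      refine Fin.cases ?_ (fun j => ?_) i <;> simp [he, consE]
    rw [this]; simp
  have hvn : ‖v‖ ≠ 0 := norm_ne_zero_iff.2 hv
  obtain ⟨U, hU⟩ : ∃ U : EuclideanSpace ℝ (Fin (n + 1)) ≃ₗᵢ[ℝ] EuclideanSpace ℝ (Fin (n + 1)),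
      U e = ‖v‖⁻¹ • v :=
    ⟨_, Submodule.reflection_sub (by rw [hen, norm_smul, norm_inv, norm_norm, inv_mul_cancel₀ hvn])⟩
  rw [← Cmat_comp_isometry U]
  refine Cmat_mem_Sset_of_const_fst hρ (hf.comp U.continuous.measurable)
    (hg.comp U.continuous.measurable) fun j z x => ?_
  rw [OU_comp_isometry U fun y => g y j, OU_comp_isometry U fun y => g y j]
  have : consE (z, x) = consE (0, x) + z • e := by
    ext i
    refine Fin.cases ?_ (fun j => ?_) i <;> simp [he, consE]
  rw [this, map_add, map_smul, hU, smul_smul, h]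

end Dimension

section LineExpansion

/-- A second-order expansion at the origin of a function of one real variable. -/
def HasLineExpansion (φ : ℝ → ℝ) (c₁ c₂ : ℝ) : Prop :=
  (fun t : ℝ => φ t - φ 0 - t * c₁ - t ^ 2 * c₂) =O[𝓝 0] (fun t => t ^ 3)

lemma HasQuadExpansion.line {F : ℝ → ℝ → ℝ} {l₁ l₂ q₁₁ q₁₂ q₂₂ : ℝ}
    (h : HasQuadExpansion F l₁ l₂ q₁₁ q₁₂ q₂₂) (a b : ℝ) :
    HasLineExpansion (fun t => F (a * t) (b * t)) (a * l₁ + b * l₂)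
      (a ^ 2 * q₁₁ + a * b * q₁₂ + b ^ 2 * q₂₂) := by
  simpa [HasLineExpansion] using h a b

lemma HasLineExpansion.add {φ ψ : ℝ → ℝ} {c₁ c₂ e₁ e₂ : ℝ} (h : HasLineExpansion φ c₁ c₂)
    (h' : HasLineExpansion ψ e₁ e₂) :
    HasLineExpansion (fun t => φ t + ψ t) (c₁ + e₁) (c₂ + e₂) :=
  (Asymptotics.IsBigO.add h h').congr_left fun t => by ring

lemma HasLineExpansion.sub {φ ψ : ℝ → ℝ} {c₁ c₂ e₁ e₂ : ℝ} (h : HasLineExpansion φ c₁ c₂)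
    (h' : HasLineExpansion ψ e₁ e₂) :
    HasLineExpansion (fun t => φ t - ψ t) (c₁ - e₁) (c₂ - e₂) :=
  (Asymptotics.IsBigO.sub h h').congr_left fun t => by ring

lemma HasLineExpansion.const_mul {φ : ℝ → ℝ} {c₁ c₂ : ℝ} (h : HasLineExpansion φ c₁ c₂) (k : ℝ) :
    HasLineExpansion (fun t => k * φ t) (k * c₁) (k * c₂) :=
  (Asymptotics.IsBigO.const_mul_left h k).congr_left fun t => by ring

lemma HasLineExpansion.sum {ι : Type*} [Fintype ι] {φ : ι → ℝ → ℝ} {c₁ c₂ : ι → ℝ}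
    (h : ∀ i, HasLineExpansion (φ i) (c₁ i) (c₂ i)) :
    HasLineExpansion (fun t => ∑ i, φ i t) (∑ i, c₁ i) (∑ i, c₂ i) :=
  (Asymptotics.IsBigO.sum (s := Finset.univ) fun i _ => h i).congr_left fun t => by
    simp only [Finset.sum_apply, Finset.sum_sub_distrib, Finset.mul_sum]

lemma HasQuadExpansion.sum_mul {ι : Type*} [Fintype ι] {F : ι → ℝ → ℝ → ℝ}
    {l₁ l₂ q₁₁ q₁₂ q₂₂ : ι → ℝ}
    (h : ∀ i, HasQuadExpansion (F i) (l₁ i) (l₂ i) (q₁₁ i) (q₁₂ i) (q₂₂ i)) (k : ι → ℝ) :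
    HasQuadExpansion (fun s τ => ∑ i, k i * F i s τ) (∑ i, k i * l₁ i) (∑ i, k i * l₂ i)
      (∑ i, k i * q₁₁ i) (∑ i, k i * q₁₂ i) (∑ i, k i * q₂₂ i) := by
  intro a b
  refine (Asymptotics.IsBigO.sum (s := Finset.univ)
    fun i _ => (h i a b).const_mul_left (k i)).congr_left fun t => ?_
  simp only [Finset.sum_apply, Finset.mul_sum, ← Finset.sum_add_distrib, ← Finset.sum_sub_distrib]
  exact Finset.sum_congr rfl fun i _ => by ring

lemma HasLineExpansion.tendsto_slope {φ : ℝ → ℝ} {c₁ c₂ : ℝ} (h : HasLineExpansion φ c₁ c₂) :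
    Tendsto (fun t => (φ t - φ 0) / t) (𝓝[≠] 0) (𝓝 c₁) := by
  obtain ⟨C, hC⟩ := h.bound
  have h0 : Tendsto (fun t : ℝ => |t| * |c₂| + C * |t| ^ 2) (𝓝[≠] 0) (𝓝 0) := by
    have : Tendsto (fun t : ℝ => |t| * |c₂| + C * |t| ^ 2) (𝓝 0)
      (𝓝 (|0| * |c₂| + C * |0| ^ 2)) := (by fun_prop : Continuous _).tendsto 0
    simpa using this.mono_left nhdsWithin_le_nhds
  refine tendsto_iff_norm_sub_tendsto_zero.2 (squeeze_zero' (Eventually.of_forall fun t =>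
    norm_nonneg _) ?_ h0)
  filter_upwards [hC.filter_mono nhdsWithin_le_nhds, self_mem_nhdsWithin] with t ht ht0
  have ht0' : t ≠ 0 := ht0
  have hpos : 0 < |t| := abs_pos.2 ht0'
  have e : (φ t - φ 0) / t - c₁ = t * c₂ + (φ t - φ 0 - t * c₁ - t ^ 2 * c₂) / t := by
    field_simp; ring
  rw [e]
  refine (norm_add_le _ _).trans (add_le_add (norm_mul_le _ _) ?_)
  rw [norm_div, Real.norm_eq_abs t, div_le_iff₀ hpos]
  rw [norm_pow, Real.norm_eq_abs t] at ht
  linarith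

lemma HasLineExpansion.tendsto_second {φ : ℝ → ℝ} {c₂ : ℝ} (h : HasLineExpansion φ 0 c₂) :
    Tendsto (fun t => (φ t - φ 0) / t ^ 2) (𝓝[≠] 0) (𝓝 c₂) := by
  obtain ⟨C, hC⟩ := h.bound
  have h0 : Tendsto (fun t : ℝ => C * |t|) (𝓝[≠] 0) (𝓝 0) := by
    have : Tendsto (fun t : ℝ => C * |t|) (𝓝 0)
      (𝓝 (C * |0|)) := (by fun_prop : Continuous _).tendsto 0
    simpa using this.mono_left nhdsWithin_le_nhds
  refine tendsto_iff_norm_sub_tendsto_zero.2 (squeeze_zero' (Eventually.of_forall fun t =>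
    norm_nonneg _) ?_ h0)
  filter_upwards [hC.filter_mono nhdsWithin_le_nhds, self_mem_nhdsWithin] with t ht ht0
  have ht0' : t ≠ 0 := ht0
  have hpos : 0 < |t| := abs_pos.2 ht0'
  have e : (φ t - φ 0) / t ^ 2 - c₂ = (φ t - φ 0 - t * 0 - t ^ 2 * c₂) / t ^ 2 := by
    field_simp; ring
  rw [e, norm_div, norm_pow, Real.norm_eq_abs t, div_le_iff₀ (by positivity)]
  rw [norm_pow, Real.norm_eq_abs t] at ht
  linarith

lemma HasLineExpansion.unique {φ : ℝ → ℝ} {c₁ c₂ e₁ e₂ : ℝ} (h : HasLineExpansion φ c₁ c₂)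
    (h' : HasLineExpansion φ e₁ e₂) : c₁ = e₁ ∧ c₂ = e₂ := by
  have h1 := tendsto_nhds_unique h.tendsto_slope h'.tendsto_slope
  refine ⟨h1, ?_⟩
  have h2 := h.sub h'
  rw [h1, sub_self] at h2
  have h3 := h2.tendsto_second
  simp only [sub_self, zero_div] at h3
  linarith [tendsto_nhds_unique h3 tendsto_const_nhds]

/-- Necessary conditions for a local maximum at the origin, up to a cubic error. -/
lemma HasLineExpansion.of_le {φ ψ : ℝ → ℝ} {c₁ c₂ : ℝ} (h : HasLineExpansion φ c₁ c₂)
    (hψ : ψ =O[𝓝 0] (fun t : ℝ => t ^ 3)) (hle : ∀ t, φ t - φ 0 ≤ ψ t) : c₁ = 0 ∧ c₂ ≤ 0 := by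
  have hψ0 : ψ 0 = 0 := by
    obtain ⟨C, hC⟩ := hψ.bound
    simpa using hC.self_of_nhds
  have h' : HasLineExpansion (fun t => φ t - ψ t) c₁ c₂ :=
    (Asymptotics.IsBigO.sub h hψ).congr_left fun t => by dsimp only; rw [hψ0]; ring
  have hneg : ∀ t, (φ t - ψ t) - (φ 0 - ψ 0) ≤ 0 := fun t => by
    rw [hψ0]; linarith [hle t]
  have h1 : c₁ = 0 := by
    have hs := h'.tendsto_slope
    refine le_antisymm ?_ ?_
    · refine le_of_tendsto (hs.mono_left (nhdsGT_le_nhdsNE 0)) ?_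
      filter_upwards [self_mem_nhdsWithin] with t ht
      exact div_nonpos_of_nonpos_of_nonneg (hneg t) (le_of_lt ht)
    · refine ge_of_tendsto (hs.mono_left (nhdsLT_le_nhdsNE 0)) ?_
      filter_upwards [self_mem_nhdsWithin] with t ht
      exact div_nonneg_of_nonpos (hneg t) (le_of_lt ht)
  refine ⟨h1, ?_⟩
  rw [h1] at h'
  exact le_of_tendsto' h'.tendsto_second fun t =>
    div_nonpos_of_nonpos_of_nonneg (hneg t) (sq_nonneg t)

lemma HasLineExpansion.nonpos {φ : ℝ → ℝ} {c₁ c₂ : ℝ} (h : HasLineExpansion φ c₁ c₂)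
    (hle : ∀ t, φ t ≤ φ 0) : c₁ = 0 ∧ c₂ ≤ 0 :=
  h.of_le (ψ := fun _ => 0) (Asymptotics.isBigO_zero _ _) fun t => by simpa using hle t

lemma HasLineExpansion.sub_sq_isBigO {φ : ℝ → ℝ} {c₂ : ℝ} (h : HasLineExpansion φ 0 c₂) :
    (fun t => (φ t - φ 0) ^ 2) =O[𝓝 0] (fun t : ℝ => t ^ 3) := by
  have h1 : (fun t => φ t - φ 0) =O[𝓝 0] (fun t : ℝ => t ^ 2) := by
    have h2 : (fun t : ℝ => t ^ 3) =O[𝓝 0] (fun t : ℝ => t ^ 2) := by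
      have := ((continuous_id.tendsto (0 : ℝ)).isBigO_one ℝ).mul
        (Asymptotics.isBigO_refl (fun t : ℝ => t ^ 2) (𝓝 0))
      simp only [one_mul] at this
      exact this.congr_left fun t => by simp only [id]; ring
    have h3 : (fun t : ℝ => t ^ 2 * c₂) =O[𝓝 0] (fun t : ℝ => t ^ 2) := by
      simpa [mul_comm] using (Asymptotics.isBigO_refl (fun t : ℝ => t ^ 2) (𝓝 0)).const_mul_left c₂
    exact ((Asymptotics.IsBigO.trans h h2).add h3).congr_left fun t => by ring
  have h4 : (fun t : ℝ => t * t ^ 3) =O[𝓝 0] (fun t : ℝ => t ^ 3) :=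
    isBigO_mul_cube continuousAt_id (Asymptotics.isBigO_refl _ _)
  exact ((h1.pow 2).congr_right fun t => by ring).trans h4

lemma quadratic_first_order {p q : ℝ} (h : ∀ a b : ℝ, (a ^ 2 - b ^ 2) * p + (a * b - b ^ 2) * q ≤ 0) :
    2 * p + q = 0 ∧ p ≤ 0 := by
  have hp : p ≤ 0 := by simpa using h 1 0
  refine ⟨?_, hp⟩
  rcases hp.eq_or_lt with rfl | hp
  · have h1 := h 2 1
    have h2 := h 0 1
    norm_num at h1 h2
    linarith
  · have := h (1 - (2 * p + q) / (2 * p)) 1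
    have e : ((1 - (2 * p + q) / (2 * p)) ^ 2 - 1 ^ 2) * p +
        ((1 - (2 * p + q) / (2 * p)) * 1 - 1 ^ 2) * q = (2 * p + q) ^ 2 / (-4 * p) := by
      have := hp.ne
      field_simp; ring
    rw [e] at this
    have h4 : 0 < -4 * p := by linarith
    have h5 : (2 * p + q) ^ 2 ≤ 0 := by
      rw [div_le_iff₀ h4] at this; linarith
    exact pow_eq_zero_iff (two_ne_zero) |>.1 (le_antisymm h5 (sq_nonneg _))

lemma nonpos_of_forall_mul_add_sq {a b : ℝ}
    (h : ∀ θ : ℝ, 0 ≤ θ → θ ≤ 1 → θ * a + θ ^ 2 * b ≤ 0) : a ≤ 0 := by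
  by_contra! ha
  have hb : 0 < |b| + a := by positivity
  have h1 := h (a / (2 * (|b| + a))) (by positivity) (by
    rw [div_le_one (by positivity)]; linarith [abs_nonneg b])
  have h2 : 0 < a / (2 * (|b| + a)) := by positivity
  have h3 : a / (2 * (|b| + a)) * |b| ≤ a / 2 := by
    rw [div_mul_eq_mul_div, div_le_div_iff₀ (by positivity) two_pos]
    nlinarith [abs_nonneg b]
  nlinarith [neg_abs_le b]

end LineExpansion

section Directional

variable {d m : ℕ} {ρ : ℝ}

instance isOpenPosMeasure_gauss (d : ℕ) : (gauss d).IsOpenPosMeasure :=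
  (volume_absolutelyContinuous_gauss d).isOpenPosMeasure

lemma integrable_mul_inner {w : EuclideanSpace ℝ (Fin d) → ℝ} (hw : UnitBdd w)
    (v : EuclideanSpace ℝ (Fin d)) : Integrable (fun x => w x * inner ℝ v x) (gauss d) :=
  (integrable_inner_gauss v).bdd_mul hw.1.aestronglyMeasurable (Eventually.of_forall hw.2)

lemma isLinearMap_integral_mul_inner {w : EuclideanSpace ℝ (Fin d) → ℝ} (hw : UnitBdd w) :
    IsLinearMap ℝ (fun v : EuclideanSpace ℝ (Fin d) => ∫ x, w x * inner ℝ v x ∂(gauss d)) where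
  map_add u v := by
    rw [← integral_add (integrable_mul_inner hw u) (integrable_mul_inner hw v)]
    simp only [inner_add_left, mul_add]
  map_smul c v := by
    rw [smul_eq_mul, ← integral_const_mul]
    simp only [real_inner_smul_left, mul_left_comm]

lemma isLinearMap_ouLin {z : EuclideanSpace ℝ (Fin d) → ℝ} (hz : UnitBdd z)
    (x : EuclideanSpace ℝ (Fin d)) : IsLinearMap ℝ (fun v => ouLin ρ z v x) :=
  isLinearMap_integral_mul_inner
    (hz.comp (φ := fun y => ρ • x + Real.sqrt (1 - ρ ^ 2) • y) (by fun_prop))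

lemma integrable_mul_ouLin {w z : EuclideanSpace ℝ (Fin d) → ℝ} (hw : UnitBdd w) (hz : UnitBdd z)
    (v : EuclideanSpace ℝ (Fin d)) : Integrable (fun x => w x * ouLin ρ z v x) (gauss d) :=
  integrable_of_bounded (hw.1.mul (measurable_ouLin hz v))
    (abs_mul_le_of_unitBdd hw (abs_ouLin_le hz v))

lemma isLinearMap_integral_mul_ouLin {w z : EuclideanSpace ℝ (Fin d) → ℝ} (hw : UnitBdd w)
    (hz : UnitBdd z) : IsLinearMap ℝ (fun v => ∫ x, w x * ouLin ρ z v x ∂(gauss d)) where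
  map_add u v := by
    rw [← integral_add (integrable_mul_ouLin hw hz u) (integrable_mul_ouLin hw hz v)]
    simp only [(isLinearMap_ouLin hz _).map_add, mul_add]
  map_smul c v := by
    rw [smul_eq_mul, ← integral_const_mul]
    simp only [(isLinearMap_ouLin hz _).map_smul, smul_eq_mul, mul_left_comm]

lemma continuous_OU (hρ : ρ ^ 2 < 1) {z : EuclideanSpace ℝ (Fin d) → ℝ} (hz : UnitBdd z) :
    Continuous (OU d ρ z) := by
  refine continuous_iff_continuousAt.2 fun x => ?_
  set r := ρ / Real.sqrt (1 - ρ ^ 2) with hr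
  have e : OU d ρ z = fun x' => ∫ y, z (ρ • x + Real.sqrt (1 - ρ ^ 2) • y) *
      shiftDensity (r • (x' - x)) y ∂(gauss d) := by
    ext x'
    have := OU_add_smul d hρ z (x' - x) x 1
    rw [one_smul, add_sub_cancel, mul_one] at this
    exact this
  rw [e]
  have hm : Measurable fun y => z (ρ • x + Real.sqrt (1 - ρ ^ 2) • y) := hz.1.comp (by fun_prop)
  refine continuousAt_of_dominated (bound := fun y => Real.exp (1 * ‖y‖)) ?_ ?_
    (integrable_exp_norm_gauss d 1) ?_
  · exact Eventually.of_forall fun x' =>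
      (hm.mul (by unfold shiftDensity; fun_prop)).aestronglyMeasurable
  · have h1 : Tendsto (fun x' => ‖r • (x' - x)‖) (𝓝 x) (𝓝 ‖r • (x - x)‖) :=
      (by fun_prop : Continuous fun x' => ‖r • (x' - x)‖).tendsto x
    rw [sub_self, smul_zero, norm_zero] at h1
    filter_upwards [h1.eventually (gt_mem_nhds one_pos)] with x' hx'
    refine Eventually.of_forall fun y => ?_
    rw [norm_mul]
    refine (mul_le_of_le_one_left (norm_nonneg _) (hz.2 _)).trans ?_
    rw [shiftDensity, Real.norm_eq_abs, Real.abs_exp, Real.exp_le_exp]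
    have h2 := real_inner_le_norm (r • (x' - x)) y
    have h3 : ‖r • (x' - x)‖ * ‖y‖ ≤ 1 * ‖y‖ := by gcongr
    nlinarith [sq_nonneg ‖r • (x' - x)‖]
  · refine Eventually.of_forall fun y => ?_
    unfold shiftDensity
    fun_prop

lemma div_sqrt_ne_zero (hρ : ρ ^ 2 < 1) (hρ0 : ρ ≠ 0) : ρ / Real.sqrt (1 - ρ ^ 2) ≠ 0 :=
  div_ne_zero hρ0 (Real.sqrt_pos.2 (by linarith)).ne'

/-- The first-order Taylor remainder of the noise-smoothed function is uniformly quadratic. -/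
lemma exists_OU_sub_le (hρ : ρ ^ 2 < 1) {z : EuclideanSpace ℝ (Fin d) → ℝ} (hz : UnitBdd z)
    (v : EuclideanSpace ℝ (Fin d)) :
    ∃ C, 0 ≤ C ∧ ∀ x (τ : ℝ), |ρ / Real.sqrt (1 - ρ ^ 2) * τ| ≤ 1 →
      |OU d ρ z (x + τ • v) - OU d ρ z x - ρ / Real.sqrt (1 - ρ ^ 2) * τ * ouLin ρ z v x| ≤
        C * (ρ / Real.sqrt (1 - ρ ^ 2) * τ) ^ 2 := by
  obtain ⟨C, hC⟩ := OU_expansion hρ v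
  refine ⟨|C| + ∫ y, |shiftQuad v y| ∂(gauss d),
    add_nonneg (abs_nonneg _) (integral_nonneg fun _ => abs_nonneg _), fun x τ hτ => ?_⟩
  set κ := ρ / Real.sqrt (1 - ρ ^ 2) * τ with hκ
  have h1 := hC z hz x τ κ rfl hτ
  have h2 := abs_ouQuad_le (ρ := ρ) hz v x
  have e : OU d ρ z (x + τ • v) - OU d ρ z x - κ * ouLin ρ z v x =
      (OU d ρ z (x + τ • v) - (OU d ρ z x + κ * ouLin ρ z v x + κ ^ 2 * ouQuad ρ z v x)) +
      κ ^ 2 * ouQuad ρ z v x := by ring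
  rw [e, add_mul]
  refine (abs_add_le _ _).trans (add_le_add (h1.trans ?_) ?_)
  · calc C * |κ| ^ 3 ≤ |C| * |κ| ^ 3 := by gcongr; exact le_abs_self C
      _ = |C| * κ ^ 2 * |κ| := by rw [pow_succ, sq_abs]; ring
      _ ≤ |C| * κ ^ 2 * 1 := by gcongr
      _ = |C| * κ ^ 2 := mul_one _
  · rw [abs_mul, abs_pow, sq_abs, mul_comm]
    gcongr

lemma continuous_ouLin (hρ : ρ ^ 2 < 1) (hρ0 : ρ ≠ 0) {z : EuclideanSpace ℝ (Fin d) → ℝ}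
    (hz : UnitBdd z) (v : EuclideanSpace ℝ (Fin d)) : Continuous (ouLin ρ z v) := by
  obtain ⟨C, hC0, hC⟩ := exists_OU_sub_le hρ hz v
  set r := ρ / Real.sqrt (1 - ρ ^ 2) with hr
  have hr0 : r ≠ 0 := div_sqrt_ne_zero hρ hρ0
  have hu : TendstoUniformly (fun (t : ℝ) x => (OU d ρ z (x + t • v) - OU d ρ z x) / (r * t))
      (ouLin ρ z v) (𝓝[≠] 0) := by
    rw [Metric.tendstoUniformly_iff]
    intro ε hε
    have h1 : Tendsto (fun t : ℝ => |r * t|) (𝓝[≠] 0) (𝓝 0) := by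
      have := (by fun_prop : Continuous fun t : ℝ => |r * t|).tendsto 0
      rw [mul_zero, abs_zero] at this
      exact this.mono_left nhdsWithin_le_nhds
    have h2 : Tendsto (fun t : ℝ => C * |r * t|) (𝓝[≠] 0) (𝓝 0) := by
      simpa using h1.const_mul C
    filter_upwards [h1.eventually (gt_mem_nhds one_pos), h2.eventually (gt_mem_nhds hε),
      self_mem_nhdsWithin] with t ht1 ht2 ht0 x
    have hk : r * t ≠ 0 := mul_ne_zero hr0 ht0
    have hk' : 0 < |r * t| := abs_pos.2 hk
    rw [dist_comm, Real.dist_eq]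
    refine lt_of_le_of_lt ?_ ht2
    have e : (OU d ρ z (x + t • v) - OU d ρ z x) / (r * t) - ouLin ρ z v x =
        (OU d ρ z (x + t • v) - OU d ρ z x - r * t * ouLin ρ z v x) / (r * t) := by
      rw [sub_div _ (r * t * _) (r * t), mul_div_cancel_left₀ _ hk]
    rw [e, abs_div, div_le_iff₀ hk', mul_assoc C, ← sq, sq_abs]
    exact hC x t ht1.le
  refine hu.continuous (Frequently.of_forall fun t => ?_)
  have := continuous_OU hρ hz
  fun_prop

lemma OU_invariant_of_ouLin_ae_eq_zero (hρ : ρ ^ 2 < 1) (hρ0 : ρ ≠ 0)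
    {z : EuclideanSpace ℝ (Fin d) → ℝ} (hz : UnitBdd z) {v : EuclideanSpace ℝ (Fin d)}
    (h : ouLin ρ z v =ᵐ[gauss d] 0) (x : EuclideanSpace ℝ (Fin d)) (t : ℝ) :
    OU d ρ z (x + t • v) = OU d ρ z x := by
  have h0 : ouLin ρ z v = 0 :=
    (Continuous.ae_eq_iff_eq (gauss d) (continuous_ouLin hρ hρ0 hz v) continuous_zero).1 h
  obtain ⟨C, hC0, hC⟩ := exists_OU_sub_le hρ hz v
  set r := ρ / Real.sqrt (1 - ρ ^ 2) with hr
  have hder : ∀ t : ℝ, HasDerivAt (fun s : ℝ => OU d ρ z (x + s • v)) 0 t := by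
    intro t
    rw [hasDerivAt_iff_isLittleO_nhds_zero]
    refine Asymptotics.IsBigO.trans_isLittleO (g := fun s : ℝ => s ^ 2) ?_ ?_
    · refine Asymptotics.IsBigO.of_bound (C * r ^ 2) ?_
      have h1 : Tendsto (fun t : ℝ => |r * t|) (𝓝 0) (𝓝 0) := by
        have := (by fun_prop : Continuous fun t : ℝ => |r * t|).tendsto 0
        rwa [mul_zero, abs_zero] at this
      filter_upwards [h1.eventually (gt_mem_nhds one_pos)] with s hs
      have := hC (x + t • v) s hs.le
      rw [h0, Pi.zero_apply, mul_zero, sub_zero] at this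
      rw [smul_zero, sub_zero, add_smul, ← add_assoc, norm_pow, Real.norm_eq_abs,
        Real.norm_eq_abs, sq_abs]
      linarith
    · simpa using Asymptotics.isLittleO_pow_pow (𝕜 := ℝ) (m := 1) (n := 2) (by norm_num)
  have := is_const_of_deriv_eq_zero (fun t => (hder t).differentiableAt)
    (fun t => (hder t).deriv) t 0
  simpa using this

lemma hasLineExpansion_sq_sub (hρ : ρ ^ 2 < 1) {z : EuclideanSpace ℝ (Fin d) → ℝ}
    (hz : UnitBdd z) (v : EuclideanSpace ℝ (Fin d)) :
    HasLineExpansion (fun t => ∫ x, (OU d ρ z (x + t • v) - OU d ρ z x) ^ 2 ∂(gauss d)) 0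
      ((ρ / Real.sqrt (1 - ρ ^ 2)) ^ 2 * ∫ x, ouLin ρ z v x ^ 2 ∂(gauss d)) := by
  obtain ⟨C, hC0, hC⟩ := exists_OU_sub_le hρ hz v
  set r := ρ / Real.sqrt (1 - ρ ^ 2) with hr
  set A := ∫ y, |inner ℝ v y| ∂(gauss d) with hA
  have hA0 : 0 ≤ A := integral_nonneg fun _ => abs_nonneg _
  have hm := measurable_ouLin (ρ := ρ) hz v
  have hW := hz.OU ρ
  refine Asymptotics.IsBigO.of_bound ((C * 2 * A + C ^ 2) * |r| ^ 3) ?_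
  have h1 : Tendsto (fun t : ℝ => |r * t|) (𝓝 0) (𝓝 0) := by
    have := (by fun_prop : Continuous fun t : ℝ => |r * t|).tendsto 0
    rwa [mul_zero, abs_zero] at this
  filter_upwards [h1.eventually (gt_mem_nhds one_pos)] with t ht
  have i1 : Integrable (fun x => (OU d ρ z (x + t • v) - OU d ρ z x) ^ 2) (gauss d) := by
    refine integrable_of_bounded (B := 2 ^ 2) (((hW.1.comp (by fun_prop)).sub hW.1).pow_const 2)
      fun x => ?_
    rw [abs_pow]
    have a1 := hW.2 x
    have a2 := hW.2 (x + t • v)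
    have := abs_sub (OU d ρ z (x + t • v)) (OU d ρ z x)
    gcongr
    linarith
  have i2 : Integrable (fun x => ouLin ρ z v x ^ 2) (gauss d) := by
    refine integrable_of_bounded (B := A ^ 2) (hm.pow_const 2) fun x => ?_
    rw [abs_pow]
    have := abs_ouLin_le (ρ := ρ) hz v x
    gcongr
  have e : (∫ x, (OU d ρ z (x + t • v) - OU d ρ z x) ^ 2 ∂(gauss d)) -
      (∫ x, (OU d ρ z (x + (0 : ℝ) • v) - OU d ρ z x) ^ 2 ∂(gauss d)) - t * 0 -
      t ^ 2 * (r ^ 2 * ∫ x, ouLin ρ z v x ^ 2 ∂(gauss d)) =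
      ∫ x, ((OU d ρ z (x + t • v) - OU d ρ z x) ^ 2 - (r * t) ^ 2 * ouLin ρ z v x ^ 2)
        ∂(gauss d) := by
    rw [integral_sub i1 (i2.const_mul _), integral_const_mul]
    simp; ring
  rw [e]
  have hb : (C * 2 * A + C ^ 2) * |r| ^ 3 * ‖t ^ 3‖ =
      ∫ _x, (C * 2 * A + C ^ 2) * |r * t| ^ 3 ∂(gauss d) := by
    rw [integral_const, probReal_univ, one_smul, norm_pow, Real.norm_eq_abs, abs_mul]; ring
  rw [hb]
  refine norm_integral_le_of_norm_le (integrable_const _) (Eventually.of_forall fun x => ?_)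
  set κ := r * t with hκ
  set D := OU d ρ z (x + t • v) - OU d ρ z x with hD
  have b1 := hC x t ht.le
  have b2 := abs_ouLin_le (ρ := ρ) hz v x
  rw [← hκ, ← hD] at b1
  set ℓ := ouLin ρ z v x with hℓ
  have e2 : D ^ 2 - κ ^ 2 * ℓ ^ 2 = (D - κ * ℓ) * (2 * (κ * ℓ) + (D - κ * ℓ)) := by ring
  rw [e2, Real.norm_eq_abs, abs_mul]
  have hκ0 := abs_nonneg κ
  have b1' : |D - κ * ℓ| ≤ C * |κ| ^ 2 := by rwa [sq_abs]
  have b3 : |2 * (κ * ℓ) + (D - κ * ℓ)| ≤ |κ| * (2 * A + C) := by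
    refine (abs_add_le _ _).trans ?_
    rw [abs_mul, abs_mul, abs_two]
    have : |κ| * |ℓ| ≤ |κ| * A := by gcongr
    have : C * |κ| ^ 2 ≤ C * |κ| := by
      refine mul_le_mul_of_nonneg_left ?_ hC0
      nlinarith
    linarith
  calc _ ≤ (C * |κ| ^ 2) * (|κ| * (2 * A + C)) := by gcongr
    _ = _ := by ring

end Directional

section Optimization

variable {d m : ℕ} {ρ : ℝ}

/-- The energy of the noise-smoothed components of `g`. -/
noncomputable def smoothEnergy (ρ : ℝ) (g : EuclideanSpace ℝ (Fin d) → Fin m → ℝ) : ℝ :=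
  ∑ j, ∫ x, OU d ρ (fun y => g y j) x * OU d ρ (fun y => g y j) x ∂(gauss d)

/-- Penalized distance to the target matrix, rewarding a large smoothed energy. -/
noncomputable def objective (ρ : ℝ) (M : Matrix (Fin m) (Fin m) ℝ) (ε : ℝ)
    (f g : EuclideanSpace ℝ (Fin d) → Fin m → ℝ) : ℝ :=
  -∑ p : Fin m × Fin m, (Cmat d m ρ f g p.1 p.2 - M p.1 p.2) ^ 2 + ε * smoothEnergy ρ g

lemma smoothEnergy_nonneg (g : EuclideanSpace ℝ (Fin d) → Fin m → ℝ) : 0 ≤ smoothEnergy ρ g :=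
  Finset.sum_nonneg fun _ _ => integral_nonneg fun _ => mul_self_nonneg _

lemma smoothEnergy_le {g : EuclideanSpace ℝ (Fin d) → Fin m → ℝ} (hg : SimplexMap d m g) :
    smoothEnergy ρ g ≤ m := by
  calc smoothEnergy ρ g ≤ ∑ _j : Fin m, (1 : ℝ) := Finset.sum_le_sum fun j _ =>
        (le_abs_self _).trans (((hg.unitBdd j).OU ρ).mul ((hg.unitBdd j).OU ρ)).abs_integral_le
    _ = m := by simp

lemma exists_maximizer (hρ : ρ ^ 2 < 1) (M : Matrix (Fin m) (Fin m) ℝ) {ε : ℝ} (hε : 0 ≤ ε)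
    {f₀ g₀ : EuclideanSpace ℝ (Fin d) → Fin m → ℝ} (hf₀ : SimplexMap d m f₀)
    (hg₀ : SimplexMap d m g₀) :
    ∃ f g, SimplexMap d m f ∧ SimplexMap d m g ∧ ∀ f' g', SimplexMap d m f' → SimplexMap d m g' →
      objective ρ M ε f' g' ≤ objective ρ M ε f g := by
  set S := {r | ∃ f g : EuclideanSpace ℝ (Fin d) → Fin m → ℝ, SimplexMap d m f ∧ SimplexMap d m g ∧
    r = objective ρ M ε f g} with hS
  have hne : S.Nonempty := ⟨_, f₀, g₀, hf₀, hg₀, rfl⟩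
  have hbdd : BddAbove S := by
    refine ⟨ε * m, ?_⟩
    rintro r ⟨f, g, hf, hg, rfl⟩
    have h1 : 0 ≤ ∑ p : Fin m × Fin m, (Cmat d m ρ f g p.1 p.2 - M p.1 p.2) ^ 2 :=
      Finset.sum_nonneg fun _ _ => sq_nonneg _
    have h2 := mul_le_mul_of_nonneg_left (smoothEnergy_le (ρ := ρ) hg) hε
    unfold objective
    linarith
  obtain ⟨u, -, hu, huS⟩ := exists_seq_tendsto_sSup hne hbdd
  choose f g hf hg hfg using huS
  obtain ⟨φ, hφ, F, G, hF, hG, hfF, hgG⟩ := exists_weakTendsto_subseq_pair hf hg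
  have hlim : Tendsto (fun k => objective ρ M ε (f (φ k)) (g (φ k))) atTop
      (𝓝 (objective ρ M ε F G)) := by
    refine ((tendsto_finsetSum _ fun p _ => ?_).neg).add ((tendsto_finsetSum _ fun j _ => ?_).const_mul ε)
    · exact ((hfF.tendsto_Cmat hρ (fun k => hf (φ k)) (fun k => hg (φ k)) hG hgG
        p.1 p.2).sub_const _).pow 2
    · exact hgG.tendsto_integral_OU_sq hρ (fun k => hg (φ k)) j
  have hlim2 : Tendsto (fun k => objective ρ M ε (f (φ k)) (g (φ k))) atTop (𝓝 (sSup S)) := by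
    simp only [← hfg]
    exact hu.comp hφ.tendsto_atTop
  refine ⟨F, G, hF, hG, fun f' g' hf' hg' => ?_⟩
  rw [tendsto_nhds_unique hlim hlim2]
  exact le_csSup hbdd ⟨f', g', hf', hg', rfl⟩

/-- Linear interpolation between two maps. -/
def mix (θ : ℝ) (f g : EuclideanSpace ℝ (Fin d) → Fin m → ℝ) :
    EuclideanSpace ℝ (Fin d) → Fin m → ℝ :=
  fun x i => f x i + θ * (g x i - f x i)

lemma SimplexMap.mix {θ : ℝ} (h0 : 0 ≤ θ) (h1 : θ ≤ 1)
    {f g : EuclideanSpace ℝ (Fin d) → Fin m → ℝ}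
    (hf : SimplexMap d m f) (hg : SimplexMap d m g) : SimplexMap d m (mix θ f g) := by
  refine ⟨measurable_pi_iff.2 fun i => ?_, fun x => ⟨fun i => ?_, ?_⟩⟩
  · exact (hf.unitBdd i).1.add (((hg.unitBdd i).1.sub (hf.unitBdd i).1).const_mul θ)
  · have a := (hf.2 x).1 i
    have b := (hg.2 x).1 i
    show 0 ≤ f x i + θ * (g x i - f x i)
    nlinarith [mul_nonneg (sub_nonneg.2 h1) a, mul_nonneg h0 b]
  · show ∑ i, (f x i + θ * (g x i - f x i)) = 1
    rw [Finset.sum_add_distrib, ← Finset.mul_sum, Finset.sum_sub_distrib, (hf.2 x).2, (hg.2 x).2]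
    ring

lemma integral_interpolate {u w : EuclideanSpace ℝ (Fin d) → ℝ} (hu : Integrable u (gauss d))
    (hw : Integrable w (gauss d)) (θ : ℝ) :
    ∫ x, (u x + θ * (w x - u x)) ∂(gauss d) =
      ∫ x, u x ∂(gauss d) + θ * (∫ x, w x ∂(gauss d) - ∫ x, u x ∂(gauss d)) := by
  have h : Integrable (fun x => θ * (w x - u x)) (gauss d) := (hw.sub hu).const_mul θ
  rw [integral_add hu h, integral_const_mul, integral_sub hw hu]

lemma OU_mix (θ : ℝ) {f g : EuclideanSpace ℝ (Fin d) → Fin m → ℝ} (hf : SimplexMap d m f)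
    (hg : SimplexMap d m g) (j : Fin m) (x : EuclideanSpace ℝ (Fin d)) :
    OU d ρ (fun y => mix θ f g y j) x = OU d ρ (fun y => f y j) x +
      θ * (OU d ρ (fun y => g y j) x - OU d ρ (fun y => f y j) x) := by
  have i1 := ((hf.unitBdd j).comp (φ := fun y => ρ • x + √(1 - ρ ^ 2) • y) (by fun_prop)).integrable
  have i2 := ((hg.unitBdd j).comp (φ := fun y => ρ • x + √(1 - ρ ^ 2) • y) (by fun_prop)).integrable
  exact integral_interpolate i1 i2 θ

lemma Cmat_mix_left (θ : ℝ) {f f' g : EuclideanSpace ℝ (Fin d) → Fin m → ℝ}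
    (hf : SimplexMap d m f) (hf' : SimplexMap d m f') (hg : SimplexMap d m g) (i j : Fin m) :
    Cmat d m ρ (mix θ f f') g i j =
      Cmat d m ρ f g i j + θ * (Cmat d m ρ f' g i j - Cmat d m ρ f g i j) := by
  have i1 := ((hf.unitBdd i).mul ((hg.unitBdd j).OU ρ)).integrable
  have i2 := ((hf'.unitBdd i).mul ((hg.unitBdd j).OU ρ)).integrable
  simp only [Cmat, Matrix.of_apply]
  rw [← integral_interpolate i1 i2 θ]
  refine integral_congr_ae (Eventually.of_forall fun x => ?_)
  simp only [mix]
  ring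

lemma Cmat_mix_right (θ : ℝ) {f g g' : EuclideanSpace ℝ (Fin d) → Fin m → ℝ}
    (hf : SimplexMap d m f) (hg : SimplexMap d m g) (hg' : SimplexMap d m g') (i j : Fin m) :
    Cmat d m ρ f (mix θ g g') i j =
      Cmat d m ρ f g i j + θ * (Cmat d m ρ f g' i j - Cmat d m ρ f g i j) := by
  have i1 := ((hf.unitBdd i).mul ((hg.unitBdd j).OU ρ)).integrable
  have i2 := ((hf.unitBdd i).mul ((hg'.unitBdd j).OU ρ)).integrable
  simp only [Cmat, Matrix.of_apply]
  rw [← integral_interpolate i1 i2 θ]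
  refine integral_congr_ae (Eventually.of_forall fun x => ?_)
  simp only [OU_mix θ hg hg' j x]
  ring

lemma exists_smoothEnergy_mix {g g' : EuclideanSpace ℝ (Fin d) → Fin m → ℝ}
    (hg : SimplexMap d m g) (hg' : SimplexMap d m g') :
    ∃ b, ∀ θ, smoothEnergy ρ (mix θ g g') = smoothEnergy ρ g +
      θ * (2 * (∑ j, ∫ x, OU d ρ (fun y => g y j) x * OU d ρ (fun y => g' y j) x ∂(gauss d) -
        smoothEnergy ρ g)) + θ ^ 2 * b := by
  refine ⟨smoothEnergy ρ g - 2 * ∑ j, ∫ x, OU d ρ (fun y => g y j) x *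
    OU d ρ (fun y => g' y j) x ∂(gauss d) + smoothEnergy ρ g', fun θ => ?_⟩
  unfold smoothEnergy
  simp only [Finset.mul_sum, ← Finset.sum_sub_distrib, ← Finset.sum_add_distrib]
  refine Finset.sum_congr rfl fun j _ => ?_
  have i1 := (((hg.unitBdd j).OU ρ).mul ((hg.unitBdd j).OU ρ)).integrable
  have i2 := (((hg.unitBdd j).OU ρ).mul ((hg'.unitBdd j).OU ρ)).integrable
  have i3 := (((hg'.unitBdd j).OU ρ).mul ((hg'.unitBdd j).OU ρ)).integrable
  have e : ∀ x, OU d ρ (fun y => mix θ g g' y j) x * OU d ρ (fun y => mix θ g g' y j) x =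
      (1 - θ) ^ 2 * (OU d ρ (fun y => g y j) x * OU d ρ (fun y => g y j) x) +
      2 * θ * (1 - θ) * (OU d ρ (fun y => g y j) x * OU d ρ (fun y => g' y j) x) +
      θ ^ 2 * (OU d ρ (fun y => g' y j) x * OU d ρ (fun y => g' y j) x) := fun x => by
    rw [OU_mix θ hg hg' j x]; ring
  have i12 : Integrable (fun x =>
      (1 - θ) ^ 2 * (OU d ρ (fun y => g y j) x * OU d ρ (fun y => g y j) x) +
      2 * θ * (1 - θ) * (OU d ρ (fun y => g y j) x * OU d ρ (fun y => g' y j) x)) (gauss d) :=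
    (i1.const_mul _).add (i2.const_mul _)
  simp only [e]
  rw [integral_add i12 (i3.const_mul _), integral_add (i1.const_mul _) (i2.const_mul _),
    integral_const_mul, integral_const_mul, integral_const_mul]
  ring

/-- The derivative of the quadratic penalty at the pair `(f, g)`. -/
noncomputable def multiplier (ρ : ℝ) (M : Matrix (Fin m) (Fin m) ℝ)
    (f g : EuclideanSpace ℝ (Fin d) → Fin m → ℝ) (p : Fin m × Fin m) : ℝ :=
  -2 * (Cmat d m ρ f g p.1 p.2 - M p.1 p.2)

lemma objective_sub (M : Matrix (Fin m) (Fin m) ℝ) (ε : ℝ)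
    (f g f' g' : EuclideanSpace ℝ (Fin d) → Fin m → ℝ) :
    objective ρ M ε f' g' - objective ρ M ε f g =
      ∑ p, multiplier ρ M f g p * (Cmat d m ρ f' g' p.1 p.2 - Cmat d m ρ f g p.1 p.2) -
      ∑ p : Fin m × Fin m, (Cmat d m ρ f' g' p.1 p.2 - Cmat d m ρ f g p.1 p.2) ^ 2 +
      ε * (smoothEnergy ρ g' - smoothEnergy ρ g) := by
  have h : ∑ p : Fin m × Fin m, (Cmat d m ρ f' g' p.1 p.2 - M p.1 p.2) ^ 2 =
      ∑ p : Fin m × Fin m, (Cmat d m ρ f g p.1 p.2 - M p.1 p.2) ^ 2 -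
      ∑ p, multiplier ρ M f g p * (Cmat d m ρ f' g' p.1 p.2 - Cmat d m ρ f g p.1 p.2) +
      ∑ p : Fin m × Fin m, (Cmat d m ρ f' g' p.1 p.2 - Cmat d m ρ f g p.1 p.2) ^ 2 := by
    rw [← Finset.sum_sub_distrib, ← Finset.sum_add_distrib]
    exact Finset.sum_congr rfl fun p _ => by unfold multiplier; ring
  unfold objective
  rw [h]; ring

/-- A pair of simplex-valued maps maximizing the objective. -/
def IsMaximizer (ρ : ℝ) (M : Matrix (Fin m) (Fin m) ℝ) (ε : ℝ)
    (f g : EuclideanSpace ℝ (Fin d) → Fin m → ℝ) : Prop :=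
  SimplexMap d m f ∧ SimplexMap d m g ∧ ∀ f' g', SimplexMap d m f' → SimplexMap d m g' →
      objective ρ M ε f' g' ≤ objective ρ M ε f g

variable {M : Matrix (Fin m) (Fin m) ℝ} {ε : ℝ} {f g : EuclideanSpace ℝ (Fin d) → Fin m → ℝ}

lemma IsMaximizer.first_order_left (h : IsMaximizer ρ M ε f g)
    {f' : EuclideanSpace ℝ (Fin d) → Fin m → ℝ} (hf' : SimplexMap d m f') :
    ∑ p, multiplier ρ M f g p * Cmat d m ρ f' g p.1 p.2 ≤
      ∑ p, multiplier ρ M f g p * Cmat d m ρ f g p.1 p.2 := by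
  obtain ⟨hf, hg, hmax⟩ := h
  rw [← sub_nonpos, ← Finset.sum_sub_distrib]
  refine nonpos_of_forall_mul_add_sq
    (b := -∑ p : Fin m × Fin m, (Cmat d m ρ f' g p.1 p.2 - Cmat d m ρ f g p.1 p.2) ^ 2)
    fun θ h0 h1 => ?_
  have h2 := sub_nonpos.2 (hmax _ g (hf.mix h0 h1 hf') hg)
  rw [objective_sub] at h2
  simp only [Cmat_mix_left θ hf hf' hg, sub_self, mul_zero, add_zero, add_sub_cancel_left] at h2
  rw [mul_neg, Finset.mul_sum, Finset.mul_sum, ← sub_eq_add_neg]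
  refine (le_of_eq ?_).trans h2
  congr 1 <;> exact Finset.sum_congr rfl fun p _ => by ring

lemma IsMaximizer.first_order_right (h : IsMaximizer ρ M ε f g)
    {g' : EuclideanSpace ℝ (Fin d) → Fin m → ℝ} (hg' : SimplexMap d m g') :
    ∑ p, multiplier ρ M f g p * Cmat d m ρ f g' p.1 p.2 +
        2 * ε * ∑ j, ∫ x, OU d ρ (fun y => g y j) x * OU d ρ (fun y => g' y j) x ∂(gauss d) ≤
      ∑ p, multiplier ρ M f g p * Cmat d m ρ f g p.1 p.2 +
        2 * ε * ∑ j, ∫ x, OU d ρ (fun y => g y j) x * OU d ρ (fun y => g y j) x ∂(gauss d) := by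
  obtain ⟨hf, hg, hmax⟩ := h
  obtain ⟨b, hb⟩ := exists_smoothEnergy_mix (ρ := ρ) hg hg'
  have key : ∑ p, multiplier ρ M f g p * (Cmat d m ρ f g' p.1 p.2 - Cmat d m ρ f g p.1 p.2) +
      ε * (2 * (∑ j, ∫ x, OU d ρ (fun y => g y j) x * OU d ρ (fun y => g' y j) x ∂(gauss d) -
        smoothEnergy ρ g)) ≤ 0 := by
    refine nonpos_of_forall_mul_add_sq (b := -∑ p : Fin m × Fin m,
      (Cmat d m ρ f g' p.1 p.2 - Cmat d m ρ f g p.1 p.2) ^ 2 + ε * b) fun θ h0 h1 => ?_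
    have h2 := sub_nonpos.2 (hmax f _ hf (hg.mix h0 h1 hg'))
    rw [objective_sub] at h2
    simp only [Cmat_mix_right θ hf hg hg', add_sub_cancel_left, hb] at h2
    refine (le_of_eq ?_).trans h2
    have e1 : ∑ p, multiplier ρ M f g p *
        (θ * (Cmat d m ρ f g' p.1 p.2 - Cmat d m ρ f g p.1 p.2)) = θ * ∑ p, multiplier ρ M f g p *
        (Cmat d m ρ f g' p.1 p.2 - Cmat d m ρ f g p.1 p.2) := by
      rw [Finset.mul_sum]
      exact Finset.sum_congr rfl fun p _ => by ring
    have e2 : ∑ p : Fin m × Fin m,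
        (θ * (Cmat d m ρ f g' p.1 p.2 - Cmat d m ρ f g p.1 p.2)) ^ 2 = θ ^ 2 * ∑ p : Fin m × Fin m,
        (Cmat d m ρ f g' p.1 p.2 - Cmat d m ρ f g p.1 p.2) ^ 2 := by
      rw [Finset.mul_sum]
      exact Finset.sum_congr rfl fun p _ => by ring
    rw [e1, e2]
    ring
  simp only [mul_sub, Finset.sum_sub_distrib] at key
  unfold smoothEnergy at key
  linarith

/-- A map maximizing a linear functional pairs at least as well as all of its translates. -/
lemma shiftCorr_le_of_integral_max (hf : SimplexMap d m f)
    {h : Fin m → EuclideanSpace ℝ (Fin d) → ℝ} (hm : ∀ i, Measurable (h i)) {B : Fin m → ℝ}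
    (hB : ∀ i x, |h i x| ≤ B i)
    (hmax : ∀ f', SimplexMap d m f' →
      ∑ i, ∫ x, f' x i * h i x ∂(gauss d) ≤ ∑ i, ∫ x, f x i * h i x ∂(gauss d))
    (v : EuclideanSpace ℝ (Fin d)) (s τ : ℝ) :
    ∑ i, shiftCorr v (fun x => f x i) (h i) s τ ≤ ∑ i, shiftCorr v (fun x => f x i) (h i) τ τ := by
  have hint : ∀ {u : EuclideanSpace ℝ (Fin d) → Fin m → ℝ}, SimplexMap d m u → ∀ i,
      Integrable (fun x => u x i * h i x) (gauss d) := fun hu i =>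
    integrable_of_bounded ((hu.unitBdd i).1.mul (hm i)) (abs_mul_le_of_unitBdd (hu.unitBdd i) (hB i))
  have hpt : ∀ u : EuclideanSpace ℝ (Fin d) → Fin m → ℝ, SimplexMap d m u →
      ∀ᵐ x ∂(gauss d), ∑ i, u x i * h i x ≤ ∑ i, f x i * h i x := by
    intro u hu
    set A := {x | ∑ i, f x i * h i x < ∑ i, u x i * h i x} with hA
    have hAm : MeasurableSet A := measurableSet_lt
      (Finset.measurable_fun_sum _ fun i _ => (hf.unitBdd i).1.mul (hm i))
      (Finset.measurable_fun_sum _ fun i _ => (hu.unitBdd i).1.mul (hm i))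
    classical
    have hw : SimplexMap d m (fun x => if x ∈ A then u x else f x) :=
      ⟨Measurable.ite hAm hu.1 hf.1, fun x => by
        dsimp only; split_ifs; exacts [hu.2 x, hf.2 x]⟩
    have h1 := hmax _ hw
    rw [← integral_finsetSum _ fun i _ => hint hw i,
      ← integral_finsetSum _ fun i _ => hint hf i] at h1
    have hle : ∀ x, ∑ i, f x i * h i x ≤ ∑ i, (if x ∈ A then u x else f x) i * h i x := by
      intro x
      by_cases hx : x ∈ A
      · simp only [hx, if_true]; exact le_of_lt hx
      · simp only [hx, if_false]; exact le_rfl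
    have h2 := (integral_eq_iff_of_ae_le (integrable_finsetSum _ fun i _ => hint hf i)
      (integrable_finsetSum _ fun i _ => hint hw i) (Eventually.of_forall hle)).1
      (le_antisymm (integral_mono (integrable_finsetSum _ fun i _ => hint hf i)
      (integrable_finsetSum _ fun i _ => hint hw i) hle) h1)
    filter_upwards [h2] with x hx
    by_contra! hlt
    have hxA : x ∈ A := hlt
    simp only [hxA, if_true] at hx
    exact hlt.ne hx
  have h3 := ae_gauss_add (hpt (fun x => f (x + (s - τ) • v)) (hf.comp (by fun_prop))) (τ • v)
  unfold shiftCorr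
  have i1 : ∀ a : ℝ, ∀ i, Integrable (fun x => f (x + a • v) i * h i (x + τ • v)) (gauss d) :=
    fun a i => integrable_of_bounded (((hf.unitBdd i).1.comp (by fun_prop)).mul
      ((hm i).comp (by fun_prop)))
      (abs_mul_le_of_unitBdd ((hf.unitBdd i).comp (φ := fun x => x + a • v) (by fun_prop))
        fun x => hB i (x + τ • v))
  rw [← integral_finsetSum _ fun i _ => i1 s i, ← integral_finsetSum _ fun i _ => i1 τ i]
  refine integral_mono_ae (integrable_finsetSum _ fun i _ => i1 s i)
    (integrable_finsetSum _ fun i _ => i1 τ i) ?_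
  filter_upwards [h3] with x hx
  rwa [add_assoc x, ← add_smul, add_sub_cancel] at hx

end Optimization

section Variation

variable {d m : ℕ} {ρ : ℝ}

lemma HasQuadExpansion.add_const_mul {F G : ℝ → ℝ → ℝ} {l₁ l₂ q₁₁ q₁₂ q₂₂ k₁ k₂ r₁₁ r₁₂ r₂₂ : ℝ}
    (hF : HasQuadExpansion F l₁ l₂ q₁₁ q₁₂ q₂₂) (hG : HasQuadExpansion G k₁ k₂ r₁₁ r₁₂ r₂₂) (c : ℝ) :
    HasQuadExpansion (fun s τ => F s τ + c * G s τ) (l₁ + c * k₁) (l₂ + c * k₂)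
      (q₁₁ + c * r₁₁) (q₁₂ + c * r₁₂) (q₂₂ + c * r₂₂) := fun a b =>
  ((hF a b).add ((hG a b).const_mul_left c)).congr_left fun t => by ring

lemma HasQuadExpansion.swap {F : ℝ → ℝ → ℝ} {l₁ l₂ q₁₁ q₁₂ q₂₂ : ℝ}
    (h : HasQuadExpansion F l₁ l₂ q₁₁ q₁₂ q₂₂) (hρ0 : ρ ≠ 0) :
    HasQuadExpansion (fun s τ => F (ρ * τ) (s / ρ)) (l₂ / ρ) (ρ * l₁) (q₂₂ / ρ ^ 2) q₁₂
      (ρ ^ 2 * q₁₁) := fun a b =>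
  (h (ρ * b) (a / ρ)).congr_left fun t => by
    dsimp only
    rw [mul_assoc, div_mul_eq_mul_div, mul_zero, zero_div]
    field_simp
    ring

lemma HasQuadExpansion.of_le_diag {F : ℝ → ℝ → ℝ} {l₁ l₂ q₁₁ q₁₂ q₂₂ : ℝ}
    (h : HasQuadExpansion F l₁ l₂ q₁₁ q₁₂ q₂₂) (hle : ∀ s τ, F s τ ≤ F τ τ) :
    2 * q₁₁ + q₁₂ = 0 ∧ q₁₁ ≤ 0 :=
  quadratic_first_order fun a b => by
    have := (((h.line a b).sub (h.line b b)).nonpos fun t => by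
      simpa using hle (a * t) (b * t)).2
    linarith

lemma shiftCorr_OU_swap (hρ : ρ ^ 2 < 1) (hρ0 : ρ ≠ 0) (v : EuclideanSpace ℝ (Fin d))
    {w z : EuclideanSpace ℝ (Fin d) → ℝ} (hw : UnitBdd w) (hz : UnitBdd z) (s τ : ℝ) :
    shiftCorr v w (OU d ρ z) s τ = shiftCorr v z (OU d ρ w) (ρ * τ) (s / ρ) := by
  have e1 : ∀ x, OU d ρ z (x + τ • v) = OU d ρ (fun y => z (y + (ρ * τ) • v)) x := fun x => by
    simp only [mul_smul, OU_comp_add]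
  have e2 : ∀ x, OU d ρ w (x + (s / ρ) • v) = OU d ρ (fun y => w (y + s • v)) x := fun x => by
    rw [← OU_comp_add, smul_smul, mul_div_cancel₀ s hρ0]
  unfold shiftCorr
  simp only [e1, e2]
  exact integral_mul_OU_comm hρ (hw.comp (by fun_prop)) (hz.comp (by fun_prop))

lemma integral_mul_sum {ι : Type*} [Fintype ι] {w : EuclideanSpace ℝ (Fin d) → ℝ} (hw : UnitBdd w)
    (k : ι → ℝ) {U : ι → EuclideanSpace ℝ (Fin d) → ℝ} (hU : ∀ o, UnitBdd (U o)) :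
    ∫ x, w x * ∑ o, k o * U o x ∂(gauss d) = ∑ o, k o * ∫ x, w x * U o x ∂(gauss d) := by
  simp only [Finset.mul_sum, ← integral_const_mul]
  rw [← integral_finsetSum _ fun o _ => ((hw.mul (hU o)).integrable.const_mul (k o))]
  exact integral_congr_ae (Eventually.of_forall fun x => Finset.sum_congr rfl fun o _ => by ring)

lemma sum_mul_shiftCorr_le {ι : Type*} [Fintype ι] {f : EuclideanSpace ℝ (Fin d) → Fin m → ℝ}
    (hf : SimplexMap d m f) (k : Fin m → ι → ℝ) {U : Fin m → ι → EuclideanSpace ℝ (Fin d) → ℝ}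
    (hU : ∀ i o, UnitBdd (U i o))
    (hmax : ∀ f', SimplexMap d m f' → ∑ i, ∑ o, k i o * ∫ x, f' x i * U i o x ∂(gauss d) ≤
      ∑ i, ∑ o, k i o * ∫ x, f x i * U i o x ∂(gauss d)) (v : EuclideanSpace ℝ (Fin d)) (s τ : ℝ) :
    ∑ i, ∑ o, k i o * shiftCorr v (fun x => f x i) (U i o) s τ ≤
      ∑ i, ∑ o, k i o * shiftCorr v (fun x => f x i) (U i o) τ τ := by
  have h := shiftCorr_le_of_integral_max hf (h := fun i x => ∑ o, k i o * U i o x)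
    (B := fun i => ∑ o, |k i o|)
    (fun i => Finset.measurable_fun_sum _ fun o _ => (hU i o).1.const_mul _)
    (fun i x => (Finset.abs_sum_le_sum_abs _ _).trans (Finset.sum_le_sum fun o _ => by
      rw [abs_mul]; exact mul_le_of_le_one_right (abs_nonneg _) ((hU i o).2 x)))
    (fun f' hf' => by
      simp only [integral_mul_sum (hf'.unitBdd _) (k _) (hU _),
        integral_mul_sum (hf.unitBdd _) (k _) (hU _)]
      exact hmax f' hf') v s τ
  have e : ∀ a b : ℝ, ∀ i, shiftCorr v (fun x => f x i) (fun x => ∑ o, k i o * U i o x) a b =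
      ∑ o, k i o * shiftCorr v (fun x => f x i) (U i o) a b := fun a b i =>
    integral_mul_sum ((hf.unitBdd i).comp (φ := fun x => x + a • v) (by fun_prop)) (k i)
      fun o => (hU i o).comp (φ := fun x => x + b • v) (by fun_prop)
  simpa only [e] using h

/-- The multiplier-weighted sum of the translated correlations of `f` and `g`. -/
noncomputable def multCorr (ρ : ℝ) (M : Matrix (Fin m) (Fin m) ℝ)
    (f g : EuclideanSpace ℝ (Fin d) → Fin m → ℝ) (v : EuclideanSpace ℝ (Fin d)) (s τ : ℝ) : ℝ :=
  ∑ p : Fin m × Fin m, multiplier ρ M f g p *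
    shiftCorr v (fun x => f x p.1) (OU d ρ fun y => g y p.2) s τ

/-- The translated self-correlations of the smoothed components of `g`. -/
noncomputable def energyCorr (ρ : ℝ) (g : EuclideanSpace ℝ (Fin d) → Fin m → ℝ)
    (v : EuclideanSpace ℝ (Fin d)) (s τ : ℝ) : ℝ :=
  ∑ j, shiftCorr v (OU d ρ fun y => g y j) (OU d ρ fun y => g y j) s τ

variable {M : Matrix (Fin m) (Fin m) ℝ} {ε : ℝ} {f g : EuclideanSpace ℝ (Fin d) → Fin m → ℝ}

lemma IsMaximizer.multCorr_le (h : IsMaximizer ρ M ε f g) (v : EuclideanSpace ℝ (Fin d)) (s τ : ℝ) :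
    multCorr ρ M f g v s τ ≤ multCorr ρ M f g v τ τ := by
  unfold multCorr
  simp only [Fintype.sum_prod_type]
  refine sum_mul_shiftCorr_le h.1 (fun i j => multiplier ρ M f g (i, j))
    (fun _ j => (h.2.1.unitBdd j).OU ρ) (fun f' hf' => ?_) v s τ
  simpa only [Fintype.sum_prod_type, Cmat, Matrix.of_apply] using h.first_order_left hf'

lemma IsMaximizer.multCorr_add_energyCorr_le (h : IsMaximizer ρ M ε f g) (hρ : ρ ^ 2 < 1)
    (hρ0 : ρ ≠ 0) (v : EuclideanSpace ℝ (Fin d)) (s τ : ℝ) :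
    multCorr ρ M f g v (ρ * τ) (s / ρ) + 2 * ε * energyCorr ρ g v (ρ * τ) (s / ρ) ≤
      multCorr ρ M f g v (ρ * τ) (τ / ρ) + 2 * ε * energyCorr ρ g v (ρ * τ) (τ / ρ) := by
  have hW : ∀ j, UnitBdd (OU d ρ fun y => g y j) := fun j => (h.2.1.unitBdd j).OU ρ
  have key := sum_mul_shiftCorr_le (ι := Option (Fin m)) h.2.1
    (fun j o => o.elim (2 * ε) fun i => multiplier ρ M f g (i, j))
    (U := fun j o => o.elim (OU d ρ (OU d ρ fun y => g y j)) fun i => OU d ρ fun y => f y i)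
    (fun j o => by
      cases o with
      | none => exact (hW j).OU ρ
      | some i => exact (h.1.unitBdd i).OU ρ)
    (fun g' hg' => by
      have e : ∀ u, SimplexMap d m u → ∑ p, multiplier ρ M f g p * Cmat d m ρ f u p.1 p.2 +
          2 * ε * ∑ j, ∫ x, OU d ρ (fun y => g y j) x * OU d ρ (fun y => u y j) x ∂(gauss d) =
          ∑ j, (2 * ε * ∫ x, u x j * OU d ρ (OU d ρ fun y => g y j) x ∂(gauss d) +
            ∑ i, multiplier ρ M f g (i, j) * ∫ x, u x j * OU d ρ (fun y => f y i) x ∂(gauss d)) := by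
        intro u hu
        simp only [Fintype.sum_prod_type, Finset.sum_add_distrib, Finset.mul_sum]
        rw [Finset.sum_comm, add_comm]
        simp only [fun j => integral_mul_OU_comm hρ (hu.unitBdd j) (hW j),
          fun i j => integral_mul_OU_comm hρ (hu.unitBdd j) (h.1.unitBdd i), Cmat, Matrix.of_apply]
      have h1 := h.first_order_right hg'
      rw [e g' hg', e g h.2.1] at h1
      simpa only [Fintype.sum_option, Option.elim] using h1) v s τ
  have e : ∀ a b : ℝ, multCorr ρ M f g v (ρ * b) (a / ρ) +
      2 * ε * energyCorr ρ g v (ρ * b) (a / ρ) =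
      ∑ j, (2 * ε * shiftCorr v (fun x => g x j) (OU d ρ (OU d ρ fun y => g y j)) a b +
        ∑ i, multiplier ρ M f g (i, j) * shiftCorr v (fun x => g x j) (OU d ρ fun y => f y i) a b) := by
    intro a b
    simp only [fun j => shiftCorr_OU_swap hρ hρ0 v (h.2.1.unitBdd j) (hW j) a b,
      fun i j => shiftCorr_OU_swap hρ hρ0 v (h.2.1.unitBdd j) (h.1.unitBdd i) a b]
    unfold multCorr energyCorr
    simp only [Fintype.sum_prod_type, Finset.sum_add_distrib, Finset.mul_sum]
    rw [Finset.sum_comm, add_comm]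
  rw [e, e]
  simpa only [Fintype.sum_option, Option.elim] using key

lemma Cmat_translate (hρ0 : ρ ≠ 0) (f g : EuclideanSpace ℝ (Fin d) → Fin m → ℝ)
    (v : EuclideanSpace ℝ (Fin d)) (t : ℝ) (i j : Fin m) :
    Cmat d m ρ (fun x => f (x + t • v)) (fun x => g (x + t • v)) i j =
      shiftCorr v (fun x => f x i) (OU d ρ fun y => g y j) t (ρ⁻¹ * t) := by
  simp only [Cmat, Matrix.of_apply, shiftCorr, ← OU_comp_add, smul_smul, mul_inv_cancel_left₀ hρ0]

lemma smoothEnergy_translate (hρ0 : ρ ≠ 0) (g : EuclideanSpace ℝ (Fin d) → Fin m → ℝ)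
    (v : EuclideanSpace ℝ (Fin d)) (t : ℝ) :
    smoothEnergy ρ (fun x => g (x + t • v)) = energyCorr ρ g v (ρ⁻¹ * t) (ρ⁻¹ * t) := by
  simp only [smoothEnergy, energyCorr, shiftCorr, ← OU_comp_add, smul_smul,
    mul_inv_cancel_left₀ hρ0]

lemma sum_Cmat (hf : SimplexMap d m f) (hg : SimplexMap d m g) :
    ∑ p : Fin m × Fin m, Cmat d m ρ f g p.1 p.2 = 1 := by
  have hOU : ∀ x, ∑ j, OU d ρ (fun y => g y j) x = 1 := fun x => by
    unfold OU
    rw [← integral_finsetSum _ fun j _ => ((hg.unitBdd j).comp (by fun_prop)).integrable]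
    simp [(hg.2 _).2]
  simp only [Fintype.sum_prod_type, Cmat, Matrix.of_apply]
  have e : ∀ i, ∑ j, ∫ x, f x i * OU d ρ (fun y => g y j) x ∂(gauss d) = ∫ x, f x i ∂(gauss d) :=
    fun i => by
      rw [← integral_finsetSum _ fun j _ => ((hf.unitBdd i).mul ((hg.unitBdd j).OU ρ)).integrable]
      simp only [← Finset.mul_sum, hOU, mul_one]
  simp only [e]
  rw [← integral_finsetSum _ fun i _ => (hf.unitBdd i).integrable]
  simp [(hf.2 _).2]

/-- The first-order variation of a correlation when both maps are translated along `v`. -/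
noncomputable def corrVariation (ρ : ℝ) (w z : EuclideanSpace ℝ (Fin d) → ℝ)
    (v : EuclideanSpace ℝ (Fin d)) : ℝ :=
  (∫ x, w x * OU d ρ z x * inner ℝ v x ∂(gauss d) -
    ρ / √(1 - ρ ^ 2) * ∫ x, w x * ouLin ρ z v x ∂(gauss d)) +
    ρ⁻¹ * (ρ / √(1 - ρ ^ 2) * ∫ x, w x * ouLin ρ z v x ∂(gauss d))

lemma isLinearMap_corrVariation {w z : EuclideanSpace ℝ (Fin d) → ℝ} (hw : UnitBdd w)
    (hz : UnitBdd z) : IsLinearMap ℝ (corrVariation ρ w z) where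
  map_add u v := by
    unfold corrVariation
    rw [(isLinearMap_integral_mul_inner (hw.mul (hz.OU ρ))).map_add,
      (isLinearMap_integral_mul_ouLin hw hz).map_add]
    ring
  map_smul c v := by
    unfold corrVariation
    rw [(isLinearMap_integral_mul_inner (hw.mul (hz.OU ρ))).map_smul,
      (isLinearMap_integral_mul_ouLin hw hz).map_smul]
    simp only [smul_eq_mul]
    ring

lemma exists_hasLineExpansion_Cmat (hρ : ρ ^ 2 < 1) (hρ0 : ρ ≠ 0) (hf : SimplexMap d m f)
    (hg : SimplexMap d m g) (v : EuclideanSpace ℝ (Fin d)) (p : Fin m × Fin m) :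
    ∃ c, HasLineExpansion
      (fun t => Cmat d m ρ (fun x => f (x + t • v)) (fun x => g (x + t • v)) p.1 p.2)
      (corrVariation ρ (fun x => f x p.1) (fun x => g x p.2) v) c := by
  obtain ⟨a, b, c, h⟩ := hasQuadExpansion_shiftCorr hρ v (hf.unitBdd p.1) (hg.unitBdd p.2)
  have h1 := h.line 1 ρ⁻¹
  simp only [one_mul] at h1
  simp only [Cmat_translate hρ0]
  exact ⟨_, h1⟩

lemma sum_corrVariation (hρ : ρ ^ 2 < 1) (hρ0 : ρ ≠ 0) (hf : SimplexMap d m f)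
    (hg : SimplexMap d m g) (v : EuclideanSpace ℝ (Fin d)) :
    ∑ p : Fin m × Fin m, corrVariation ρ (fun x => f x p.1) (fun x => g x p.2) v = 0 := by
  choose c hc using exists_hasLineExpansion_Cmat hρ hρ0 hf hg v
  have h := HasLineExpansion.sum hc
  have e : ∀ t : ℝ, ∑ p : Fin m × Fin m,
      Cmat d m ρ (fun x => f (x + t • v)) (fun x => g (x + t • v)) p.1 p.2 = 1 := fun t =>
    sum_Cmat (hf.comp (by fun_prop)) (hg.comp (by fun_prop))
  simp only [e] at h
  exact (h.unique (e₁ := 0) (e₂ := 0) (by simp [HasLineExpansion, Asymptotics.isBigO_zero])).1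

lemma exists_direction (hρ : ρ ^ 2 < 1) (hρ0 : ρ ≠ 0) (hf : SimplexMap d m f)
    (hg : SimplexMap d m g) (hm : 0 < m) (hd : m ^ 2 - 1 < d) :
    ∃ v : EuclideanSpace ℝ (Fin d), v ≠ 0 ∧
      ∀ p : Fin m × Fin m, corrVariation ρ (fun x => f x p.1) (fun x => g x p.2) v = 0 := by
  set p₀ : Fin m × Fin m := (⟨0, hm⟩, ⟨0, hm⟩)
  let L : EuclideanSpace ℝ (Fin d) →ₗ[ℝ] ({p : Fin m × Fin m // p ≠ p₀} → ℝ) :=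
    LinearMap.pi fun p => (isLinearMap_corrVariation (ρ := ρ)
      (hf.unitBdd p.1.1) (hg.unitBdd p.1.2)).mk' _
  have hker : LinearMap.ker L ≠ ⊥ := by
    refine LinearMap.ker_ne_bot_of_finrank_lt ?_
    rw [Module.finrank_fintype_fun_eq_card, finrank_euclideanSpace_fin,
      Fintype.card_subtype_compl, Fintype.card_prod, Fintype.card_fin, Fintype.card_subtype_eq,
      ← sq]
    exact hd
  obtain ⟨v, hv, hv0⟩ := Submodule.exists_mem_ne_zero_of_ne_bot hker
  have h1 : ∀ p, p ≠ p₀ → corrVariation ρ (fun x => f x p.1) (fun x => g x p.2) v = 0 :=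
    fun p hp => congrFun (LinearMap.mem_ker.1 hv) ⟨p, hp⟩
  refine ⟨v, hv0, fun p => ?_⟩
  by_cases hp : p = p₀
  · rw [hp, ← Fintype.sum_eq_single p₀ h1]
    exact sum_corrVariation hρ hρ0 hf hg v
  · exact h1 p hp

end Variation

section Descent

variable {d m n : ℕ} {ρ ε : ℝ} {M : Matrix (Fin m) (Fin m) ℝ}
  {f g : EuclideanSpace ℝ (Fin d) → Fin m → ℝ}

lemma exists_hasQuadExpansion_multCorr (hρ : ρ ^ 2 < 1) (hf : SimplexMap d m f)
    (hg : SimplexMap d m g) (v : EuclideanSpace ℝ (Fin d)) :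
    ∃ l₁ l₂ q₁₁ q₁₂ q₂₂, HasQuadExpansion (multCorr ρ M f g v) l₁ l₂ q₁₁ q₁₂ q₂₂ := by
  choose a b c h using fun p : Fin m × Fin m =>
    hasQuadExpansion_shiftCorr hρ v (hf.unitBdd p.1) (hg.unitBdd p.2)
  exact ⟨_, _, _, _, _, HasQuadExpansion.sum_mul h (multiplier ρ M f g)⟩

lemma energyCorr_comm (g : EuclideanSpace ℝ (Fin d) → Fin m → ℝ) (v : EuclideanSpace ℝ (Fin d))
    (s τ : ℝ) : energyCorr ρ g v s τ = energyCorr ρ g v τ s := by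
  simp only [energyCorr, shiftCorr, mul_comm]

lemma sum_integral_sq_sub (hg : SimplexMap d m g) (v : EuclideanSpace ℝ (Fin d)) (t : ℝ) :
    ∑ j, ∫ x, (OU d ρ (fun y => g y j) (x + t • v) - OU d ρ (fun y => g y j) x) ^ 2 ∂(gauss d) =
      energyCorr ρ g v t t - energyCorr ρ g v t 0 - energyCorr ρ g v 0 t +
        energyCorr ρ g v 0 0 := by
  simp only [energyCorr, ← Finset.sum_sub_distrib, ← Finset.sum_add_distrib]
  refine Finset.sum_congr rfl fun j _ => ?_
  have hu : ∀ a b : ℝ, Integrable (fun x => OU d ρ (fun y => g y j) (x + a • v) *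
      OU d ρ (fun y => g y j) (x + b • v)) (gauss d) := fun a b =>
    ((((hg.unitBdd j).OU ρ).comp (φ := fun x => x + a • v) (by fun_prop)).mul
      (((hg.unitBdd j).OU ρ).comp (φ := fun x => x + b • v) (by fun_prop))).integrable
  unfold shiftCorr
  rw [← integral_sub' (hu _ _) (hu _ _), ← integral_sub' ((hu _ _).sub (hu _ _)) (hu _ _),
    ← integral_add' (((hu _ _).sub (hu _ _)).sub (hu _ _)) (hu _ _)]
  refine integral_congr_ae (Eventually.of_forall fun x => ?_)
  simp only [Pi.sub_apply, Pi.add_apply, zero_smul, add_zero]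
  ring

lemma exists_hasQuadExpansion_energyCorr (hρ : ρ ^ 2 < 1) (hg : SimplexMap d m g)
    (v : EuclideanSpace ℝ (Fin d)) :
    ∃ l₁ l₂ q, HasQuadExpansion (energyCorr ρ g v) l₁ l₂ q
      ((ρ / √(1 - ρ ^ 2)) ^ 2 * ∑ j, ∫ x, ouLin ρ (fun y => g y j) v x ^ 2 ∂(gauss d)) q := by
  choose a b c h using fun j : Fin m =>
    hasQuadExpansion_shiftCorr hρ v ((hg.unitBdd j).OU ρ) (hg.unitBdd j)
  have hN := HasQuadExpansion.sum_mul h fun _ => 1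
  simp only [one_mul] at hN
  have h1 := hN.line 1 0
  have h2 := hN.line 0 1
  have h3 := hN.line 1 1
  have e : ∀ s τ, ∑ i, shiftCorr v (OU d ρ fun x => g x i) (OU d ρ fun x => g x i) s τ =
      energyCorr ρ g v s τ := fun _ _ => rfl
  simp only [e, one_mul, zero_mul] at h1 h2 h3
  have h4 : ∑ j, a j = ∑ j, c j := by
    simp only [energyCorr_comm g v 0] at h2
    simpa using (h1.unique h2).2
  have h5 := (h3.sub h1).sub h2
  have h6 := HasLineExpansion.sum fun j => hasLineExpansion_sq_sub hρ (hg.unitBdd j) v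
  simp only [sum_integral_sq_sub hg v] at h6
  have h7 : HasLineExpansion (fun _ => energyCorr ρ g v 0 0) 0 0 := by
    simp [HasLineExpansion, Asymptotics.isBigO_zero]
  have h8 := ((h5.add h7).unique h6).2
  rw [← Finset.mul_sum] at h8
  have h9 : ∑ j, b j = (ρ / √(1 - ρ ^ 2)) ^ 2 *
      ∑ j, ∫ x, ouLin ρ (fun y => g y j) v x ^ 2 ∂(gauss d) := by linarith
  rw [h9, ← h4] at hN
  exact ⟨_, _, _, hN⟩

lemma IsMaximizer.translate_le (h : IsMaximizer ρ M ε f g) (hρ0 : ρ ≠ 0)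
    (v : EuclideanSpace ℝ (Fin d)) (t : ℝ) :
    (multCorr ρ M f g v t (ρ⁻¹ * t) + ε * energyCorr ρ g v (ρ⁻¹ * t) (ρ⁻¹ * t)) -
      (multCorr ρ M f g v 0 0 + ε * energyCorr ρ g v 0 0) ≤
      ∑ p : Fin m × Fin m,
        (Cmat d m ρ (fun x => f (x + t • v)) (fun x => g (x + t • v)) p.1 p.2 -
          Cmat d m ρ (fun x => f (x + (0 : ℝ) • v)) (fun x => g (x + (0 : ℝ) • v)) p.1 p.2) ^ 2 := by
  have h1 := sub_nonpos.2 (h.2.2 (fun x => f (x + t • v)) (fun x => g (x + t • v))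
    (h.1.comp (by fun_prop)) (h.2.1.comp (by fun_prop)))
  rw [objective_sub] at h1
  have e0 : energyCorr ρ g v 0 0 = smoothEnergy ρ g := by
    simp [energyCorr, smoothEnergy, shiftCorr]
  have e1 : multCorr ρ M f g v 0 0 = ∑ p, multiplier ρ M f g p * Cmat d m ρ f g p.1 p.2 := by
    simp [multCorr, Cmat, shiftCorr]
  have e2 : multCorr ρ M f g v t (ρ⁻¹ * t) = ∑ p, multiplier ρ M f g p *
      Cmat d m ρ (fun x => f (x + t • v)) (fun x => g (x + t • v)) p.1 p.2 := by
    simp only [multCorr, Cmat_translate hρ0]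
  rw [e0, e1, e2, ← smoothEnergy_translate hρ0]
  simp only [mul_sub, Finset.sum_sub_distrib] at h1
  simp only [zero_smul, add_zero]
  linarith

lemma IsMaximizer.OU_invariant (h : IsMaximizer ρ M ε f g) (hε : 0 < ε) (hρ0 : 0 < ρ) (hρ1 : ρ < 1)
    {v : EuclideanSpace ℝ (Fin d)}
    (hv : ∀ p : Fin m × Fin m, corrVariation ρ (fun x => f x p.1) (fun x => g x p.2) v = 0)
    (j : Fin m) (x : EuclideanSpace ℝ (Fin d)) (t : ℝ) :
    OU d ρ (fun y => g y j) (x + t • v) = OU d ρ (fun y => g y j) x := by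
  have hρ : ρ ^ 2 < 1 := by nlinarith
  obtain ⟨hf, hg, -⟩ := id h
  obtain ⟨l₁, l₂, p₁₁, p₁₂, p₂₂, hΦ⟩ := exists_hasQuadExpansion_multCorr (M := M) hρ hf hg v
  obtain ⟨k₁, k₂, q, hN⟩ := exists_hasQuadExpansion_energyCorr hρ hg v
  set E := (ρ / √(1 - ρ ^ 2)) ^ 2 * ∑ j, ∫ x, ouLin ρ (fun y => g y j) v x ^ 2 ∂(gauss d) with hE
  obtain ⟨hl, hp⟩ := hΦ.of_le_diag (h.multCorr_le v)
  have hr := (((hΦ.add_const_mul hN (2 * ε)).swap hρ0.ne').of_le_diag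
    (h.multCorr_add_energyCorr_le hρ hρ0.ne' v)).1
  choose c hc using exists_hasLineExpansion_Cmat hρ hρ0.ne' hf hg v
  have ht := (((hΦ.line 1 ρ⁻¹).add ((hN.line ρ⁻¹ ρ⁻¹).const_mul ε)).of_le
    (Asymptotics.IsBigO.fun_sum (s := Finset.univ) fun p _ => (by
      have := hc p
      rw [hv p] at this
      exact this.sub_sq_isBigO)) fun t => by
    simpa only [one_mul, mul_zero] using h.translate_le hρ0.ne' v t).2
  have hE0 : E ≤ 0 := by
    set y := ρ⁻¹ with hy
    have hy1 : 1 < y := (one_lt_inv₀ hρ0).2 hρ1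
    have hr' : 2 * ((p₂₂ + 2 * ε * q) * y ^ 2) + (p₁₂ + 2 * ε * E) = 0 := by
      rw [← hr, hy]; field_simp
    have h1 : p₁₂ * (y - 1) + ε * E * (y ^ 2 - 1) ≤ 0 := by nlinarith
    have h2 : 0 ≤ p₁₂ * (y - 1) := mul_nonneg (by linarith) (by linarith)
    have h3 : 0 < ε * (y ^ 2 - 1) := mul_pos hε (by nlinarith)
    by_contra! hcon
    nlinarith [mul_pos h3 hcon]
  have hnn : ∀ i, 0 ≤ ∫ x, ouLin ρ (fun y => g y i) v x ^ 2 ∂(gauss d) := fun i =>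
    integral_nonneg fun _ => sq_nonneg _
  have hsum : ∑ i, ∫ x, ouLin ρ (fun y => g y i) v x ^ 2 ∂(gauss d) = 0 := by
    have h1 : 0 < (ρ / √(1 - ρ ^ 2)) ^ 2 :=
      pow_pos (div_pos hρ0 (Real.sqrt_pos.2 (by linarith))) 2
    have h2 := Finset.sum_nonneg fun i (_ : i ∈ Finset.univ) => hnn i
    nlinarith
  have hj := (Finset.sum_eq_zero_iff_of_nonneg fun i _ => hnn i).1 hsum j (Finset.mem_univ j)
  have hint : Integrable (fun x => ouLin ρ (fun y => g y j) v x ^ 2) (gauss d) :=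
    integrable_of_bounded ((measurable_ouLin (hg.unitBdd j) v).pow_const 2) fun x => by
      rw [abs_pow]; exact pow_le_pow_left₀ (abs_nonneg _) (abs_ouLin_le (hg.unitBdd j) v x) 2
  have hae := (integral_eq_zero_iff_of_nonneg (fun _ => sq_nonneg _) hint).1 hj
  refine OU_invariant_of_ouLin_ae_eq_zero hρ hρ0.ne' (hg.unitBdd j) ?_ x t
  filter_upwards [hae] with x hx
  exact pow_eq_zero_iff two_ne_zero |>.1 hx

lemma Sset_succ_subset_of_pos (hρ0 : 0 < ρ) (hρ1 : ρ < 1) (hm : 0 < m) (hn : m ^ 2 - 1 ≤ n) :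
    Sset ρ m (n + 1) ⊆ Sset ρ m n := by
  have hρ : ρ ^ 2 < 1 := by nlinarith
  rintro M ⟨f₀, g₀, hf₀, hg₀, hM⟩
  have key : ∀ k : ℕ, ∃ A ∈ Sset ρ m n,
      ∑ p : Fin m × Fin m, (A p.1 p.2 - M p.1 p.2) ^ 2 ≤ 1 / ((k : ℝ) + 1) * m := by
    intro k
    have hε : (0 : ℝ) < 1 / ((k : ℝ) + 1) := by positivity
    obtain ⟨f, g, hf, hg, hmax⟩ := exists_maximizer hρ M hε.le hf₀ hg₀
    obtain ⟨v, hv0, hv⟩ := exists_direction hρ hρ0.ne' hf hg hm (Nat.lt_succ_of_le hn)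
    refine ⟨_, Cmat_mem_Sset_of_invariant hρ hf hg hv0
      (IsMaximizer.OU_invariant ⟨hf, hg, hmax⟩ hε hρ0 hρ1 hv), ?_⟩
    have h1 := hmax f₀ g₀ hf₀ hg₀
    unfold objective at h1
    rw [← hM] at h1
    simp only [sub_self, ne_eq, OfNat.ofNat_ne_zero, not_false_eq_true, zero_pow,
      Finset.sum_const_zero, neg_zero, zero_add] at h1
    have h2 := mul_nonneg hε.le (smoothEnergy_nonneg (ρ := ρ) g₀)
    have h3 := mul_le_mul_of_nonneg_left (smoothEnergy_le (ρ := ρ) hg) hε.le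
    linarith
  choose A hA hAM using key
  refine (isClosed_Sset hρ m n).mem_of_tendsto (f := A) (b := atTop) ?_
    (Eventually.of_forall hA)
  have hlim : Tendsto (fun k : ℕ => 1 / ((k : ℝ) + 1) * m) atTop (𝓝 0) := by
    simpa using (tendsto_one_div_add_atTop_nhds_zero_nat (𝕜 := ℝ)).mul_const (m : ℝ)
  refine tendsto_pi_nhds.2 fun i => tendsto_pi_nhds.2 fun j => ?_
  have hsq : Tendsto (fun k => (A k i j - M i j) ^ 2) atTop (𝓝 0) :=
    squeeze_zero (fun k => sq_nonneg _) (fun k =>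
      (Finset.single_le_sum (f := fun p : Fin m × Fin m => (A k p.1 p.2 - M p.1 p.2) ^ 2)
        (fun p _ => sq_nonneg _) (Finset.mem_univ (i, j))).trans (hAM k)) hlim
  have habs := hsq.sqrt
  simp only [Real.sqrt_sq_eq_abs, Real.sqrt_zero] at habs
  exact tendsto_iff_norm_sub_tendsto_zero.2 habs

lemma Sset_succ_subset_zero : Sset 0 m (n + 1) ⊆ Sset 0 m n := by
  rintro M ⟨f, g, hf, hg, rfl⟩
  refine Cmat_mem_Sset_of_invariant (by norm_num) hf hg
    (v := EuclideanSpace.single 0 1) (by simp) fun j x t => ?_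
  simp [OU]

lemma Sset_succ_subset (hρ₁ : -1 < ρ) (hρ₂ : ρ < 1) (hm : 0 < m) (hn : m ^ 2 - 1 ≤ n) :
    Sset ρ m (n + 1) ⊆ Sset ρ m n := by
  rcases lt_trichotomy ρ 0 with h | rfl | h
  · rw [← Sset_neg ρ m (n + 1), ← Sset_neg ρ m n]
    exact Sset_succ_subset_of_pos (by linarith) (by linarith) hm hn
  · exact Sset_succ_subset_zero
  · exact Sset_succ_subset_of_pos h hρ₂ hm hn

end Descent

theorem gaussian_noninteractive_simulation_dimension_free
    (ρ : ℝ) (hρ₁ : -1 < ρ) (hρ₂ : ρ < 1) (m : ℕ) (hm : 2 ≤ m) :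
    Sset ρ m (m ^ 2 - 1) = closure (⋃ j : ℕ, ⋃ _ : 1 ≤ j, Sset ρ m j) := by
  have hρ : ρ ^ 2 < 1 := by nlinarith
  have hup : Monotone (Sset ρ m) := monotone_nat_of_le_succ (Sset_subset_succ ρ m)
  have hdown : ∀ k, Sset ρ m (m ^ 2 - 1 + k) ⊆ Sset ρ m (m ^ 2 - 1) := fun k => by
    induction k with
    | zero => exact subset_rfl
    | succ k ih =>
      exact (Sset_succ_subset hρ₁ hρ₂ (by lia) (Nat.le_add_right _ k)).trans ih
  refine Set.Subset.antisymm ?_ (closure_minimal ?_ (isClosed_Sset hρ m _))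
  · have h1 : 1 ≤ m ^ 2 - 1 := Nat.le_sub_of_add_le (by nlinarith)
    exact (Set.subset_biUnion_of_mem (u := Sset ρ m) (s := {j | 1 ≤ j}) h1).trans subset_closure
  · refine Set.iUnion₂_subset fun j _ => ?_
    rcases le_total j (m ^ 2 - 1) with h | h
    · exact hup h
    · obtain ⟨k, rfl⟩ := Nat.exists_eq_add_of_le h
      exact hdown k
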